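/- (Factorization of graded decomposition matrices.) In the setting where A is integrally closed in its field of fractions K, H is a Z-graded associative A-algebra finitely generated and free over A, θ : A → L and θ' : A → L' are specializations with Ker(θ) ⊆ Ker(θ'), φ ∘ θ = θ' with φ extending to a ring B integrally closed in L, and LH and L'H are split, the graded decomposition matrices with entries in N[q,q^{-1}] satisfy the matrix identity D^gr_{θ'}(q) = D^gr_{θ,θ'}(q) · D^gr_θ(q). -/

import Mathlib

universe u

open DirectSum Function

/-! ## Modules over `S ⊗_A H`

For an `A`-algebra `H` and a commutative `A`-algebra `S`, a (finitely generated) module over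
the `S`-algebra `S ⊗_A H` is the same thing as an `S`-module together with a commuting
`H`-action such that the two induced `A`-actions agree.  We package this data in a structure. -/

structure ModPkg (A : Type u) [CommRing A] (H : Type u) [Ring H] [Algebra A H]
    (S : Type u) [CommRing S] [Algebra A S] : Type (u + 1) where
  carrier : Type u
  [acg : AddCommGroup carrier]
  [modS : Module S carrier]
  [modH : Module H carrier]
  smul_comm' : ∀ (h : H) (s : S) (x : carrier), h • s • x = s • h • x
  compat : ∀ (a : A) (x : carrier), (algebraMap A H a) • x = (algebraMap A S a) • x
  [fin : Module.Finite S carrier]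

attribute [instance] ModPkg.acg ModPkg.modS ModPkg.modH ModPkg.fin

section Ungraded

variable {A : Type u} [CommRing A] {H : Type u} [Ring H] [Algebra A H]
  {S : Type u} [CommRing S] [Algebra A S]

namespace ModPkg

/-- A subgroup stable under both scalar actions, i.e. an `S ⊗_A H`-submodule. -/
def IsStable (M : ModPkg A H S) (p : AddSubgroup M.carrier) : Prop :=
  (∀ (s : S), ∀ x ∈ p, s • x ∈ p) ∧ (∀ (h : H), ∀ x ∈ p, h • x ∈ p)

/-- Simplicity of an `S ⊗_A H`-module. -/
def Simple (M : ModPkg A H S) : Prop :=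
  Nontrivial M.carrier ∧ ∀ p : AddSubgroup M.carrier, M.IsStable p → p = ⊥ ∨ p = ⊤

/-- Isomorphism of `S ⊗_A H`-modules. -/
def Iso (M N : ModPkg A H S) : Prop :=
  ∃ e : M.carrier ≃+ N.carrier,
    (∀ (s : S) (x : M.carrier), e (s • x) = s • e x) ∧
    (∀ (h : H) (x : M.carrier), e (h • x) = h • e x)

/-- The action of an element of `H` as an `S`-linear endomorphism. -/
noncomputable def act (M : ModPkg A H S) (h : H) : M.carrier →ₗ[S] M.carrier where
  toFun x := h • x
  map_add' x y := smul_add h x y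
  map_smul' s x := by simpa using M.smul_comm' h s x

/-- The character of an `S ⊗_A H`-module, as a function on `H`. -/
noncomputable def char (M : ModPkg A H S) : H → S :=
  fun h => LinearMap.trace S M.carrier (M.act h)

/-- The factor `q/p` is isomorphic to `M` (as `S ⊗_A H`-modules), witnessed by a surjection
`q → M` with kernel `p`. -/
def IsFactor (V : ModPkg A H S) (p q : AddSubgroup V.carrier) (M : ModPkg A H S) : Prop :=
  ∃ φ : q →+ M.carrier,
    Surjective φ ∧
    (∀ x : q, φ x = 0 ↔ (x : V.carrier) ∈ p) ∧
    (∀ (s : S) (x y : q), (y : V.carrier) = s • (x : V.carrier) → φ y = s • φ x) ∧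
    (∀ (h : H) (x y : q), (y : V.carrier) = h • (x : V.carrier) → φ y = h • φ x)

end ModPkg

/-- An (ungraded) composition series of an `S ⊗_A H`-module. -/
structure CompSeries (V : ModPkg A H S) : Type u where
  len : ℕ
  c : Fin (len + 1) → AddSubgroup V.carrier
  mono : ∀ t : Fin len, c t.castSucc ≤ c t.succ
  bot : c 0 = ⊥
  top : c (Fin.last len) = ⊤
  stable : ∀ t, V.IsStable (c t)
  steps : ∀ t : Fin len, c t.castSucc ≠ c t.succ ∧
    ∀ p : AddSubgroup V.carrier, V.IsStable p → c t.castSucc ≤ p → p ≤ c t.succ →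
      p = c t.castSucc ∨ p = c t.succ

/-- The multiplicity of the simple module `M` in a composition series. -/
noncomputable def ModPkg.mult (V : ModPkg A H S) (cs : CompSeries V) (M : ModPkg A H S) : ℕ :=
  Nat.card { t : Fin cs.len // V.IsFactor (cs.c t.castSucc) (cs.c t.succ) M }

end Ungraded

/-- The algebra `S ⊗_A H` is split: the endomorphism algebra of every simple module is `S`. -/
def SplitAlg (A : Type u) [CommRing A] (H : Type u) [Ring H] [Algebra A H]
    (S : Type u) [CommRing S] [Algebra A S] : Prop :=
  ∀ M : ModPkg A H S, M.Simple →
    ∀ f : M.carrier →+ M.carrier,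
      (∀ (s : S) (x : M.carrier), f (s • x) = s • f x) →
      (∀ (h : H) (x : M.carrier), f (h • x) = h • f x) →
      ∃ s : S, ∀ x, f x = s • x

/-- The set of irreducible characters of `S ⊗_A H`. -/
def IrrChars (A : Type u) [CommRing A] (H : Type u) [Ring H] [Algebra A H]
    (S : Type u) [CommRing S] [Algebra A S] : Set (H → S) :=
  { χ | ∃ M : ModPkg A H S, M.Simple ∧ χ = M.char }

/-! ## Graded modules over `S ⊗_A H` for a `ℤ`-graded algebra `H = ⊕ 𝒜 i` -/

structure GrMod (A : Type u) [CommRing A] (H : Type u) [Ring H] [Algebra A H]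
    (𝒜 : ℤ → Submodule A H) (S : Type u) [CommRing S] [Algebra A S] : Type (u + 1) where
  carrier : Type u
  [acg : AddCommGroup carrier]
  [modS : Module S carrier]
  [modH : Module H carrier]
  smul_comm' : ∀ (h : H) (s : S) (x : carrier), h • s • x = s • h • x
  compat : ∀ (a : A) (x : carrier), (algebraMap A H a) • x = (algebraMap A S a) • x
  [fin : Module.Finite S carrier]
  grading : ℤ → Submodule S carrier
  [decomp : DirectSum.Decomposition grading]
  grading_smul : ∀ (i j : ℤ) (h : H), h ∈ 𝒜 i → ∀ x ∈ grading j, h • x ∈ grading (i + j)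

attribute [instance] GrMod.acg GrMod.modS GrMod.modH GrMod.fin GrMod.decomp

section Graded

variable {A : Type u} [CommRing A] {H : Type u} [Ring H] [Algebra A H]
  {𝒜 : ℤ → Submodule A H} {S : Type u} [CommRing S] [Algebra A S]

namespace GrMod

/-- The underlying ungraded module of a graded module. -/
def forget (V : GrMod A H 𝒜 S) : ModPkg A H S where
  carrier := V.carrier
  acg := V.acg
  modS := V.modS
  modH := V.modH
  smul_comm' := V.smul_comm'
  compat := V.compat
  fin := V.fin

/-- The action of a degree-`0` element of `H` on the degree-`i` piece of a graded module,
as an `S`-linear endomorphism; this is the representation `ρ_{V_i}` restricted to `H_0`. -/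
noncomputable def degAct (V : GrMod A H 𝒜 S) (h : 𝒜 0) (i : ℤ) :
    V.grading i →ₗ[S] V.grading i where
  toFun x := ⟨(h : H) • (x : V.carrier), by
    simpa using V.grading_smul 0 i (h : H) h.2 (x : V.carrier) x.2⟩
  map_add' x y := by
    apply Subtype.ext
    simp [smul_add]
  map_smul' s x := by
    apply Subtype.ext
    simpa using V.smul_comm' (h : H) s (x : V.carrier)

/-- A subgroup which is an `S ⊗_A H`-submodule and is graded. -/
def IsGrSub (V : GrMod A H 𝒜 S) (p : AddSubgroup V.carrier) : Prop :=
  V.forget.IsStable p ∧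
    ∀ x ∈ p, ∀ i : ℤ, ((DirectSum.decompose V.grading x i : V.grading i) : V.carrier) ∈ p

/-- A graded module is graded-simple if it is nonzero and has no nontrivial graded submodule. -/
def GrSimple (V : GrMod A H 𝒜 S) : Prop :=
  Nontrivial V.carrier ∧ ∀ p : AddSubgroup V.carrier, V.IsGrSub p → p = ⊥ ∨ p = ⊤

/-- Isomorphism of graded modules. -/
def GrIso (V W : GrMod A H 𝒜 S) : Prop :=
  ∃ e : V.carrier ≃+ W.carrier,
    (∀ (s : S) (x : V.carrier), e (s • x) = s • e x) ∧
    (∀ (h : H) (x : V.carrier), e (h • x) = h • e x) ∧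
    (∀ (i : ℤ), ∀ x ∈ V.grading i, e x ∈ W.grading i)

/-- `W` is the shift `V⟨j⟩` of `V`, i.e. `W_i = V_{i-j}`. -/
def IsShiftOf (W V : GrMod A H 𝒜 S) (j : ℤ) : Prop :=
  ∃ e : W.carrier ≃+ V.carrier,
    (∀ (s : S) (x : W.carrier), e (s • x) = s • e x) ∧
    (∀ (h : H) (x : W.carrier), e (h • x) = h • e x) ∧
    (∀ (i : ℤ), ∀ x ∈ W.grading i, e x ∈ V.grading (i - j))

/-- The factor `q/p` of a graded module is isomorphic, as a graded module, to the shift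
`M⟨n⟩` of `M`. -/
def IsFactorShift (V : GrMod A H 𝒜 S) (p q : AddSubgroup V.carrier)
    (M : GrMod A H 𝒜 S) (n : ℤ) : Prop :=
  ∃ φ : q →+ M.carrier,
    Surjective φ ∧
    (∀ x : q, φ x = 0 ↔ (x : V.carrier) ∈ p) ∧
    (∀ (s : S) (x y : q), (y : V.carrier) = s • (x : V.carrier) → φ y = s • φ x) ∧
    (∀ (h : H) (x y : q), (y : V.carrier) = h • (x : V.carrier) → φ y = h • φ x) ∧
    (∀ (i : ℤ) (x : q), (x : V.carrier) ∈ V.grading i → φ x ∈ M.grading (i - n)) ∧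
    (∀ (i : ℤ), ∀ m ∈ M.grading (i - n), ∃ x : q, (x : V.carrier) ∈ V.grading i ∧ φ x = m)

end GrMod

/-- A graded composition series of a graded module. -/
structure GrCompSeries (V : GrMod A H 𝒜 S) : Type u where
  len : ℕ
  c : Fin (len + 1) → AddSubgroup V.carrier
  mono : ∀ t : Fin len, c t.castSucc ≤ c t.succ
  bot : c 0 = ⊥
  top : c (Fin.last len) = ⊤
  graded : ∀ t, V.IsGrSub (c t)
  steps : ∀ t : Fin len, c t.castSucc ≠ c t.succ ∧
    ∀ p : AddSubgroup V.carrier, V.IsGrSub p → c t.castSucc ≤ p → p ≤ c t.succ →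
      p = c t.castSucc ∨ p = c t.succ

/-- The multiplicity `[V : M⟨n⟩]^gr` of the shifted graded simple module `M⟨n⟩` in a graded
composition series of `V`. -/
noncomputable def GrMod.multShift (V : GrMod A H 𝒜 S) (cs : GrCompSeries V)
    (M : GrMod A H 𝒜 S) (n : ℤ) : ℕ :=
  Nat.card { t : Fin cs.len // V.IsFactorShift (cs.c t.castSucc) (cs.c t.succ) M n }

/-- The graded decomposition number `∑_n q^n [V : M⟨n⟩]^gr ∈ ℕ[q,q⁻¹]`. -/
noncomputable def GrMod.entryPoly (V : GrMod A H 𝒜 S) (cs : GrCompSeries V)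
    (M : GrMod A H 𝒜 S) : LaurentPolynomial ℕ :=
  ∑ᶠ n : ℤ, (V.multShift cs M n) • LaurentPolynomial.T n

/-- A short exact sequence of graded modules (morphisms are of degree `0`). -/
structure GrSES (X Y Z : GrMod A H 𝒜 S) : Type u where
  f : X.carrier →+ Y.carrier
  g : Y.carrier →+ Z.carrier
  f_smulS : ∀ (s : S) (x : X.carrier), f (s • x) = s • f x
  f_smulH : ∀ (h : H) (x : X.carrier), f (h • x) = h • f x
  g_smulS : ∀ (s : S) (y : Y.carrier), g (s • y) = s • g y
  g_smulH : ∀ (h : H) (y : Y.carrier), g (h • y) = h • g y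
  inj : Injective f
  surj : Surjective g
  exact : ∀ y : Y.carrier, g y = 0 ↔ ∃ x, f x = y
  f_graded : ∀ (i : ℤ), ∀ x ∈ X.grading i, f x ∈ Y.grading i
  g_graded : ∀ (i : ℤ), ∀ y ∈ Y.grading i, g y ∈ Z.grading i

end Graded

/-- The defining relations of the Grothendieck group of finite-dimensional graded modules. -/
def grRelSet (A : Type u) [CommRing A] (H : Type u) [Ring H] [Algebra A H]
    (𝒜 : ℤ → Submodule A H) (S : Type u) [CommRing S] [Algebra A S] :
    Set (FreeAbelianGroup (GrMod A H 𝒜 S)) :=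
  { z | ∃ X Y Z : GrMod A H 𝒜 S, Nonempty (GrSES X Y Z) ∧
      z = FreeAbelianGroup.of Y - FreeAbelianGroup.of X - FreeAbelianGroup.of Z }

/-- The Grothendieck group `R_0(S ⊗_A H)` of finite-dimensional graded modules. -/
def Groth (A : Type u) [CommRing A] (H : Type u) [Ring H] [Algebra A H]
    (𝒜 : ℤ → Submodule A H) (S : Type u) [CommRing S] [Algebra A S] : Type (u + 1) :=
  FreeAbelianGroup (GrMod A H 𝒜 S) ⧸ AddSubgroup.closure (grRelSet A H 𝒜 S)

noncomputable instance (A : Type u) [CommRing A] (H : Type u) [Ring H] [Algebra A H]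
    (𝒜 : ℤ → Submodule A H) (S : Type u) [CommRing S] [Algebra A S] :
    AddCommGroup (Groth A H 𝒜 S) :=
  inferInstanceAs
    (AddCommGroup (FreeAbelianGroup (GrMod A H 𝒜 S) ⧸ AddSubgroup.closure (grRelSet A H 𝒜 S)))

/-- The class `[V]` of a graded module in the Grothendieck group; `R_0^+` is the set of
all such classes. -/
def GrMod.cls {A : Type u} [CommRing A] {H : Type u} [Ring H] [Algebra A H]
    {𝒜 : ℤ → Submodule A H} {S : Type u} [CommRing S] [Algebra A S]
    (V : GrMod A H 𝒜 S) : Groth A H 𝒜 S :=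
  QuotientAddGroup.mk (FreeAbelianGroup.of V)

section Char

variable {A : Type u} [CommRing A] {H : Type u} [Ring H] [Algebra A H]
  {𝒜 : ℤ → Submodule A H} {S : Type u} [CommRing S] [Algebra A S]

/-- The graded character of a graded module, as a function `H → S[t,t⁻¹]`:
it vanishes on the components of degree `≠ 0` and sends `h₀ ∈ H_0` to
`∑_i t^i χ_{V_i}(h₀)`. -/
noncomputable def GrMod.grChar [DirectSum.Decomposition 𝒜] (V : GrMod A H 𝒜 S) :
    H → LaurentPolynomial S :=
  fun h => ∑ᶠ i : ℤ, LaurentPolynomial.T i *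
    LaurentPolynomial.C
      (LinearMap.trace S (V.grading i) (V.degAct (DirectSum.decompose 𝒜 h 0) i))

/-- The set of irreducible graded characters `{χ^gr_{M⟨j⟩}}`: graded characters of graded
modules whose underlying ungraded module is simple (the grading of a simple module being
unique up to shift). -/
def IrrGrChars (A : Type u) [CommRing A] (H : Type u) [Ring H] [Algebra A H]
    (𝒜 : ℤ → Submodule A H) [DirectSum.Decomposition 𝒜]
    (S : Type u) [CommRing S] [Algebra A S] : Set (H → LaurentPolynomial S) :=
  { χ | ∃ V : GrMod A H 𝒜 S, V.forget.Simple ∧ χ = V.grChar }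

end Char

section FieldCoeffs

variable {A : Type u} [CommRing A] {H : Type u} [Ring H] [Algebra A H]
  {𝒜 : ℤ → Submodule A H} {F : Type u} [Field F] [Algebra A F]

/-- The characteristic polynomial of the action of a degree-`0` element of `H` on the
degree-`i` piece of a graded module. -/
noncomputable def GrMod.cpoly (V : GrMod A H 𝒜 F) (h : 𝒜 0) (i : ℤ) : Polynomial F :=
  LinearMap.charpoly (V.degAct h i)

/-- `L` is a graded `O ⊗_A H`-lattice in the graded `F ⊗_A H`-module `V`: an `O`-submodule,
stable under `H`, graded, finitely generated and free over `O`, any `O`-basis of which is an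
`F`-basis of `V`. -/
def GrMod.IsLattice (O : ValuationSubring F) (V : GrMod A H 𝒜 F)
    (L : AddSubgroup V.carrier) : Prop :=
  (∀ c : F, c ∈ O → ∀ x ∈ L, c • x ∈ L) ∧
  (∀ h : H, ∀ x ∈ L, h • x ∈ L) ∧
  (∀ x ∈ L, ∀ i : ℤ, ((DirectSum.decompose V.grading x i : V.grading i) : V.carrier) ∈ L) ∧
  ∃ (n : ℕ) (b : Fin n → V.carrier),
    LinearIndependent F b ∧ Submodule.span F (Set.range b) = ⊤ ∧ (∀ m, b m ∈ L) ∧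
    (∀ x ∈ L, ∃ c : Fin n → F, (∀ m, c m ∈ O) ∧ x = ∑ m, c m • b m)

/-- The subgroup `J(O)·L` of a lattice `L`, where `J(O)` is the maximal ideal
(= nonunits) of the valuation ring `O`. -/
def GrMod.mSub (O : ValuationSubring F) (V : GrMod A H 𝒜 F)
    (L : AddSubgroup V.carrier) : AddSubgroup V.carrier :=
  AddSubgroup.closure { z | ∃ c : O, ¬ IsUnit c ∧ ∃ y ∈ L, z = (c : F) • y }

/-- `φ` exhibits the graded `k ⊗_A H`-module `Y` as the modular reduction `k ⊗_O L` of the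
graded `O ⊗_A H`-lattice `L`, along the surjection `π : O → k` onto the residue field. -/
def GrMod.Reduces {k : Type u} [Field k] [Algebra A k]
    (O : ValuationSubring F) (π : O →+* k)
    (V : GrMod A H 𝒜 F) (L : AddSubgroup V.carrier)
    (Y : GrMod A H 𝒜 k) (φ : L →+ Y.carrier) : Prop :=
  Surjective φ ∧
  (∀ x : L, φ x = 0 ↔ (x : V.carrier) ∈ GrMod.mSub O V L) ∧
  (∀ (c : O) (x y : L), (y : V.carrier) = (c : F) • (x : V.carrier) → φ y = π c • φ x) ∧
  (∀ (h : H) (x y : L), (y : V.carrier) = h • (x : V.carrier) → φ y = h • φ x) ∧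
  (∀ (i : ℤ) (x : L), (x : V.carrier) ∈ V.grading i → φ x ∈ Y.grading i) ∧
  (∀ i : ℤ, ∀ y ∈ Y.grading i, ∃ x : L, (x : V.carrier) ∈ V.grading i ∧ φ x = y)

end FieldCoeffs


section LinAlg

open Module

/-- The characteristic polynomial is multiplicative along an invariant submodule. -/
theorem charpoly_eq_mul_aux {R V : Type*} [Field R] [AddCommGroup V]
    [Module R V] [Module.Finite R V] (W : Submodule R V)
    (e : V →ₗ[R] V) (he : W ≤ W.comap e) :
    e.charpoly = (e.restrict he).charpoly * (W.mapQ W e he).charpoly := by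
  classical
  let m := Module.Free.ChooseBasisIndex R W
  let bW : Basis m R W := Module.Free.chooseBasis R W
  let n := Module.Free.ChooseBasisIndex R (V ⧸ W)
  let bQ : Basis n R (V ⧸ W) := Module.Free.chooseBasis R (V ⧸ W)
  let b := Basis.sumQuot bW bQ
  let A : Matrix m m R := LinearMap.toMatrix bW bW (e.restrict he)
  let B : Matrix m n R := Matrix.of fun i l ↦
    ((Basis.sumQuot bW bQ).repr (e ((Basis.sumQuot bW bQ) (Sum.inr l)))) (Sum.inl i)
  let D : Matrix n n R := LinearMap.toMatrix bQ bQ (W.mapQ W e he)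
  suffices LinearMap.toMatrix b b e = Matrix.fromBlocks A B 0 D by
    rw [← LinearMap.charpoly_toMatrix e b, this, ← LinearMap.charpoly_toMatrix _ bW,
      ← LinearMap.charpoly_toMatrix _ bQ, Matrix.charpoly_fromBlocks_zero₂₁]
  ext u v
  cases u with
  | inl i =>
    cases v with
    | inl k =>
      simp only [b, Basis.sumQuot_inl, Matrix.fromBlocks_apply₁₁, A, LinearMap.toMatrix_apply]
      apply Basis.sumQuot_repr_inl_of_mem
    | inr l => simp [b, LinearMap.toMatrix_apply, Matrix.fromBlocks_apply₁₂, B]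
  | inr j =>
    cases v with
    | inl k =>
      suffices W.mkQ (e (bW k)) = 0 by simp [LinearMap.toMatrix_apply, b, this]
      rw [← LinearMap.mem_ker, Submodule.ker_mkQ]
      exact he (Submodule.coe_mem (bW k))
    | inr l =>
      simp only [LinearMap.toMatrix_apply, Basis.sumQuot_repr_inr,
        Matrix.fromBlocks_apply₂₂, b, D]
      rw [← Basis.sumQuot_inr bW bQ l, W.mapQ_apply]
      simp

theorem charpoly_equiv_aux {R V W : Type*} [Field R] [AddCommGroup V] [AddCommGroup W]
    [Module R V] [Module.Finite R V] [Module R W] [Module.Finite R W]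
    (e : V ≃ₗ[R] W) (f : V →ₗ[R] V) (g : W →ₗ[R] W) (h : ∀ x, e (f x) = g (e x)) :
    f.charpoly = g.charpoly := by
  have : g = e.conj f := by
    ext x
    simp [LinearEquiv.conj_apply, h]
  rw [this, LinearEquiv.charpoly_conj]

/-- Multiplicativity along a short exact sequence. -/
theorem charpoly_ses_aux {R X Y Z : Type*} [Field R] [AddCommGroup X] [AddCommGroup Y]
    [AddCommGroup Z] [Module R X] [Module.Finite R X] [Module R Y] [Module.Finite R Y]
    [Module R Z] [Module.Finite R Z] (i : X →ₗ[R] Y) (p : Y →ₗ[R] Z)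
    (hi : Function.Injective i) (hp : Function.Surjective p)
    (hip : LinearMap.range i = LinearMap.ker p)
    (f : X →ₗ[R] X) (g : Y →ₗ[R] Y) (k : Z →ₗ[R] Z)
    (h1 : ∀ x, i (f x) = g (i x)) (h2 : ∀ y, p (g y) = k (p y)) :
    g.charpoly = f.charpoly * k.charpoly := by
  have he : LinearMap.range i ≤ (LinearMap.range i).comap g := by
    rintro _ ⟨x, rfl⟩
    exact ⟨f x, h1 x⟩
  rw [charpoly_eq_mul_aux (LinearMap.range i) g he]
  congr 1
  · refine (charpoly_equiv_aux (LinearEquiv.ofInjective i hi) _ _ ?_).symm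
    intro x
    apply Subtype.ext
    simp [h1]
  · refine charpoly_equiv_aux ((Submodule.quotEquivOfEq _ _ hip).trans
      (p.quotKerEquivOfSurjective hp)) _ _ ?_
    intro x
    induction x using Submodule.Quotient.induction_on with
    | H x => simp [h2]

/-- Multiplicativity along a filtration. -/
theorem charpoly_chain_aux {R U : Type*} [Field R] [AddCommGroup U] [Module R U]
    [Module.Finite R U] (f : U →ₗ[R] U) (n : ℕ) (P : Fin (n + 1) → Submodule R U)
    (hinv : ∀ t, P t ≤ (P t).comap f)
    (hmono : ∀ t : Fin n, P t.castSucc ≤ P t.succ) (hbot : P 0 = ⊥) (htop : P (Fin.last n) = ⊤)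
    (Z : Fin n → Type*) [∀ t, AddCommGroup (Z t)] [∀ t, Module R (Z t)]
    [∀ t, Module.Finite R (Z t)] (g : ∀ t, Z t →ₗ[R] Z t)
    (ψ : ∀ t : Fin n, P t.succ →ₗ[R] Z t) (hψ : ∀ t, Function.Surjective (ψ t))
    (hker : ∀ t x, ψ t x = 0 ↔ (x : U) ∈ P t.castSucc)
    (hfg : ∀ t x, ψ t (f.restrict (hinv t.succ) x) = g t (ψ t x)) :
    f.charpoly = ∏ t, (g t).charpoly := by
  have key : ∀ k : ℕ, ∀ hk : k ≤ n, (f.restrict (hinv ⟨k, by omega⟩)).charpoly =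
      ∏ t : Fin k, (g ⟨t, by omega⟩).charpoly := by
    intro k
    induction k with
    | zero =>
      intro hk
      simp only [Finset.univ_eq_empty, Finset.prod_empty]
      have : Subsingleton (P ⟨0, by omega⟩) := by
        change Subsingleton (P 0)
        rw [hbot]
        infer_instance
      apply Polynomial.eq_one_of_monic_natDegree_zero (LinearMap.charpoly_monic _)
      rw [LinearMap.charpoly_natDegree]
      exact finrank_zero_of_subsingleton
    | succ k ih =>
      intro hk
      rw [Fin.prod_univ_castSucc]
      have := ih (by omega)
      simp only [Fin.val_castSucc, Fin.val_last]
      rw [← this]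
      let t : Fin n := ⟨k, by omega⟩
      refine charpoly_ses_aux (Submodule.inclusion (hmono t)) (ψ t)
        (Submodule.inclusion_injective _) (hψ t) ?_ (f.restrict (hinv t.castSucc))
          (f.restrict (hinv t.succ)) (g t) ?_ (hfg t)
      · rw [Submodule.range_inclusion]
        ext x
        simp [hker]
      · intro x
        rfl
  have h := key n le_rfl
  simp only [Fin.eta] at h
  rw [← h]
  have htop' : P ⟨n, by omega⟩ = ⊤ := htop
  refine charpoly_equiv_aux ((Submodule.topEquiv (R := R) (M := U)).symm.trans
    (LinearEquiv.ofEq _ _ htop'.symm)) _ _ ?_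
  intro x
  rfl

/-- If `f` is annihilated by a monic polynomial over an integrally closed domain, its
characteristic polynomial is defined over this domain. -/
theorem charpoly_integral_aux {A K U : Type*} [CommRing A] [IsDomain A] [IsIntegrallyClosed A]
    [Field K] [Algebra A K] [IsFractionRing A K] [AddCommGroup U] [Module K U]
    [Module.Finite K U] (f : U →ₗ[K] U) (p : Polynomial A) (hp : p.Monic)
    (hpf : Polynomial.aeval f (p.map (algebraMap A K)) = 0) :
    ∃ c : Polynomial A, c.map (algebraMap A K) = f.charpoly := by
  classical
  have hIntl : ∀ i, IsIntegral A (f.charpoly.coeff i) := by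
    intro i
    let Ω := AlgebraicClosure K
    let b := Module.finBasis K U
    let M := LinearMap.toMatrix b b f
    have hM : M.charpoly = f.charpoly := LinearMap.charpoly_toMatrix f b
    let M' := M.map (algebraMap K Ω)
    have hpM : Polynomial.aeval M (p.map (algebraMap A K)) = 0 := by
      have : M = LinearMap.toMatrixAlgEquiv b f := rfl
      rw [this, Polynomial.aeval_algHom_apply, hpf, map_zero]
    have hpM' : Polynomial.aeval M' (p.map (algebraMap A K)) = 0 := by
      have : M' = (Algebra.ofId K Ω).mapMatrix M := rfl
      rw [this, Polynomial.aeval_algHom_apply, hpM, map_zero]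
    have hc : M'.charpoly = f.charpoly.map (algebraMap K Ω) := by
      rw [← hM]; exact Matrix.charpoly_map M (algebraMap K Ω)
    have h2 : IsIntegral A (M'.charpoly.coeff i) := by
      apply Polynomial.isIntegral_coeff_of_factors
      · rw [(Matrix.charpoly_monic M').leadingCoeff]; exact isIntegral_one
      · exact IsAlgClosed.splits _
      · intro x hx
        have hx' : Module.End.HasEigenvalue (Matrix.toLin' M') x := by
          rw [Module.End.hasEigenvalue_iff_isRoot_charpoly, Matrix.charpoly_toLin']
          exact hx
        obtain ⟨v, hv⟩ := hx'.exists_hasEigenvector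
        have h3 := Module.End.aeval_apply_of_hasEigenvector
          (p := (p.map (algebraMap A K)).map (algebraMap K Ω)) hv
        rw [Polynomial.aeval_map_algebraMap] at h3
        have h4 : Polynomial.aeval (Matrix.toLin' M') (p.map (algebraMap A K)) = 0 := by
          have : Matrix.toLin' M' = ((Matrix.toLinAlgEquiv' (R := Ω)).restrictScalars K) M' := rfl
          rw [this, Polynomial.aeval_algHom_apply, hpM', map_zero]
        rw [h4] at h3
        have h5 := (smul_eq_zero.mp h3.symm).resolve_right hv.2
        refine ⟨p, hp, ?_⟩
        rw [Polynomial.map_map, Polynomial.eval_map] at h5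
        rw [IsScalarTower.algebraMap_eq A K Ω]
        exact h5
    rw [hc, Polynomial.coeff_map] at h2
    exact (isIntegral_algebraMap_iff (algebraMap K Ω).injective).mp h2
  have hl : f.charpoly ∈ Polynomial.lifts (algebraMap A K) := by
    rw [Polynomial.lifts_iff_coeff_lifts]
    intro i
    obtain ⟨a, ha⟩ := IsIntegrallyClosed.isIntegral_iff.mp (hIntl i)
    exact ⟨a, ha⟩
  exact (Polynomial.mem_lifts _).mp hl

end LinAlg


section GradedBasics

variable {A : Type u} [CommRing A] {H : Type u} [Ring H] [Algebra A H]
  {𝒜 : ℤ → Submodule A H} {S : Type u} [CommRing S] [Algebra A S]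

namespace GrMod

/-- Stability, stated on the carrier of the graded module. -/
def Stab (V : GrMod A H 𝒜 S) (p : AddSubgroup V.carrier) : Prop :=
  (∀ (s : S), ∀ x ∈ p, s • x ∈ p) ∧ (∀ (h : H), ∀ x ∈ p, h • x ∈ p)

/-- Projection to the degree `i` component. -/
noncomputable def pr (V : GrMod A H 𝒜 S) (i : ℤ) : V.carrier →ₗ[S] V.carrier :=
  (V.grading i).subtype ∘ₗ (DirectSum.component S ℤ (fun i => V.grading i) i) ∘ₗ
    (DirectSum.decomposeLinearEquiv V.grading).toLinearMap

theorem pr_apply (V : GrMod A H 𝒜 S) (i : ℤ) (x : V.carrier) :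
    V.pr i x = ((DirectSum.decompose V.grading x i : V.grading i) : V.carrier) := rfl

theorem pr_mem (V : GrMod A H 𝒜 S) (i : ℤ) (x : V.carrier) : V.pr i x ∈ V.grading i :=
  (DirectSum.decompose V.grading x i).2

theorem pr_same (V : GrMod A H 𝒜 S) {i : ℤ} {x : V.carrier} (h : x ∈ V.grading i) :
    V.pr i x = x := DirectSum.decompose_of_mem_same _ h

theorem pr_ne (V : GrMod A H 𝒜 S) {i j : ℤ} {x : V.carrier} (h : x ∈ V.grading i)
    (hij : i ≠ j) : V.pr j x = 0 := DirectSum.decompose_of_mem_ne _ h hij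

theorem simple_iff (V : GrMod A H 𝒜 S) : V.forget.Simple ↔ Nontrivial V.carrier ∧
    ∀ p : AddSubgroup V.carrier, V.Stab p → p = ⊥ ∨ p = ⊤ := Iff.rfl

theorem isGrSub_iff (V : GrMod A H 𝒜 S) (p : AddSubgroup V.carrier) :
    V.IsGrSub p ↔ V.Stab p ∧ ∀ x ∈ p, ∀ i : ℤ, V.pr i x ∈ p := Iff.rfl

theorem exists_sum_pr (V : GrMod A H 𝒜 S) (x : V.carrier) :
    ∃ s : Finset ℤ, ∑ i ∈ s, V.pr i x = x := by
  classical
  exact ⟨_, DirectSum.sum_support_decompose V.grading x⟩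

theorem ext_pr (V : GrMod A H 𝒜 S) {x y : V.carrier} (h : ∀ i, V.pr i x = V.pr i y) :
    x = y := by
  obtain ⟨s, hs⟩ := V.exists_sum_pr (x - y)
  have : x - y = 0 := by
    rw [← hs]
    refine Finset.sum_eq_zero fun i _ => ?_
    rw [map_sub, h, sub_self]
  exact sub_eq_zero.mp this

theorem mem_grading_iff (V : GrMod A H 𝒜 S) {i : ℤ} {x : V.carrier} :
    x ∈ V.grading i ↔ ∀ j, j ≠ i → V.pr j x = 0 := by
  constructor
  · intro h j hj
    exact V.pr_ne h hj.symm
  · intro h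
    have : x = V.pr i x := by
      apply V.ext_pr
      intro j
      by_cases hj : j = i
      · subst hj
        rw [V.pr_same (V.pr_mem j x)]
      · rw [h j hj, V.pr_ne (V.pr_mem i x) (Ne.symm hj)]
    rw [this]
    exact V.pr_mem i x

@[elab_as_elim]
theorem homog_induction (V : GrMod A H 𝒜 S) {motive : V.carrier → Prop} (zero : motive 0)
    (homogeneous : ∀ i, ∀ x ∈ V.grading i, motive x)
    (add : ∀ m m', motive m → motive m' → motive (m + m')) (x : V.carrier) : motive x :=
  DirectSum.Decomposition.inductionOn V.grading zero (fun {i} m => homogeneous i m m.2) add x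

/-- A homogeneous additive map commutes with projections. -/
theorem pr_map (V W : GrMod A H 𝒜 S) (f : V.carrier →+ W.carrier) (k : ℤ)
    (hf : ∀ i, ∀ x ∈ V.grading i, f x ∈ W.grading (i + k)) (i : ℤ) (x : V.carrier) :
    W.pr (i + k) (f x) = f (V.pr i x) := by
  induction x using V.homog_induction with
  | zero => simp
  | homogeneous j x hx =>
    by_cases h : j = i
    · subst h
      rw [V.pr_same hx, W.pr_same (hf _ _ hx)]
    · rw [V.pr_ne hx h, map_zero, W.pr_ne (hf _ _ hx) (by omega)]
  | add x y hx hy => simp only [map_add, hx, hy]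

theorem pr_smul (V : GrMod A H 𝒜 S) {d : ℤ} {h : H} (hh : h ∈ 𝒜 d) (i : ℤ) (x : V.carrier) :
    V.pr (i + d) (h • x) = h • V.pr i x := by
  refine V.pr_map V (DistribSMul.toAddMonoidHom V.carrier h) d ?_ i x
  intro i x hx
  rw [add_comm]
  exact V.grading_smul d i h hh x hx

theorem isInternal (V : GrMod A H 𝒜 S) : DirectSum.IsInternal V.grading :=
  DirectSum.Decomposition.isInternal _

theorem exists_pr_ne_zero (V : GrMod A H 𝒜 S) {x : V.carrier} (hx : x ≠ 0) :
    ∃ i, V.pr i x ≠ 0 := by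
  by_contra hcon
  push Not at hcon
  exact hx (V.ext_pr fun i => by rw [hcon i, map_zero])

/-- Inverse of a bijective homogeneous map is homogeneous. -/
theorem mem_of_map_mem (V W : GrMod A H 𝒜 S) (f : V.carrier →+ W.carrier) (k : ℤ)
    (hinj : Injective f)
    (hf : ∀ i, ∀ x ∈ V.grading i, f x ∈ W.grading (i + k)) (i : ℤ) (x : V.carrier)
    (hx : f x ∈ W.grading (i + k)) : x ∈ V.grading i := by
  rw [V.mem_grading_iff]
  intro j hj
  apply hinj
  rw [← V.pr_map W f k hf, W.pr_ne hx (by omega), map_zero]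

theorem IsShiftOf.refl (V : GrMod A H 𝒜 S) : V.IsShiftOf V 0 :=
  ⟨AddEquiv.refl _, fun _ _ => rfl, fun _ _ => rfl, fun i x hx => by simpa using hx⟩

theorem IsShiftOf.symm {V W : GrMod A H 𝒜 S} {j : ℤ} (h : W.IsShiftOf V j) :
    V.IsShiftOf W (-j) := by
  obtain ⟨e, h1, h2, h3⟩ := h
  refine ⟨e.symm, ?_, ?_, ?_⟩
  · intro s x
    apply e.injective
    simp [h1]
  · intro s x
    apply e.injective
    simp [h2]
  · intro i x hx
    refine W.mem_of_map_mem V e.toAddMonoidHom (-j) e.injective h3 _ _ ?_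
    simpa using hx

theorem IsShiftOf.trans {U V W : GrMod A H 𝒜 S} {j k : ℤ} (h : U.IsShiftOf V j)
    (h' : V.IsShiftOf W k) : U.IsShiftOf W (j + k) := by
  obtain ⟨e, h1, h2, h3⟩ := h
  obtain ⟨e', h1', h2', h3'⟩ := h'
  refine ⟨e.trans e', ?_, ?_, ?_⟩
  · intro s x
    simp [h1, h1']
  · intro s x
    simp [h2, h2']
  · intro i x hx
    rw [← sub_sub]
    exact h3' _ _ (h3 _ _ hx)

end GrMod

end GradedBasics

section GradedField

variable {A : Type u} [CommRing A] {H : Type u} [Ring H] [Algebra A H]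
  {𝒜 : ℤ → Submodule A H} {F : Type u} [Field F] [Algebra A F]

namespace GrMod

theorem finite_degrees (V : GrMod A H 𝒜 F) : {i | V.grading i ≠ ⊥}.Finite :=
  WellFoundedGT.finite_ne_bot_of_iSupIndep V.isInternal.submodule_iSupIndep

theorem IsShiftOf.eq_zero {V : GrMod A H 𝒜 F} (hV : Nontrivial V.carrier) {k : ℤ}
    (h : V.IsShiftOf V k) : k = 0 := by
  have h' := h.symm
  have key : ∀ k : ℤ, V.IsShiftOf V k → ∀ i, V.grading i ≠ ⊥ → V.grading (i - k) ≠ ⊥ := by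
    rintro k ⟨e, h1, h2, h3⟩ i hi
    obtain ⟨x, hx, hx0⟩ := (Submodule.ne_bot_iff _).mp hi
    rw [Submodule.ne_bot_iff]
    exact ⟨e x, h3 _ _ hx, by simpa using hx0⟩
  have hne : (V.finite_degrees.toFinset).Nonempty := by
    obtain ⟨x, hx⟩ := exists_ne (0 : V.carrier)
    obtain ⟨i, hi⟩ := V.exists_pr_ne_zero hx
    refine ⟨i, ?_⟩
    simp only [Set.Finite.mem_toFinset, Set.mem_ofPred_eq, Submodule.ne_bot_iff]
    exact ⟨_, V.pr_mem i x, hi⟩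
  have hmax := Finset.max'_mem _ hne
  rw [Set.Finite.mem_toFinset, Set.mem_ofPred_eq] at hmax
  have a1 := Finset.le_max' V.finite_degrees.toFinset _
    ((Set.Finite.mem_toFinset _).mpr (key _ h _ hmax))
  have a2 := Finset.le_max' V.finite_degrees.toFinset _
    ((Set.Finite.mem_toFinset _).mpr (key _ h' _ hmax))
  omega

theorem IsShiftOf.unique {V W : GrMod A H 𝒜 F} (hV : Nontrivial V.carrier) {j k : ℤ}
    (h : V.IsShiftOf W j) (h' : V.IsShiftOf W k) : j = k := by
  have := (h.trans h'.symm).eq_zero hV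
  omega

/-- Stability under `F` and `H` as an `F`-submodule. -/
def stableSub (V : GrMod A H 𝒜 F) (p : AddSubgroup V.carrier) (hp : V.Stab p) :
    Submodule F V.carrier where
  carrier := p
  add_mem' := p.add_mem
  zero_mem' := p.zero_mem
  smul_mem' := fun s x hx => hp.1 s x hx

/-- Graded Schur lemma. -/
theorem bijective_of_homog {V W : GrMod A H 𝒜 F} (hV : V.GrSimple) (hW : W.GrSimple)
    (f : V.carrier →ₗ[F] W.carrier) (hH : ∀ (h : H) x, f (h • x) = h • f x) (k : ℤ)
    (hf : ∀ i, ∀ x ∈ V.grading i, f x ∈ W.grading (i + k)) (hne : ∃ x, f x ≠ 0) :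
    Bijective f := by
  have hpr := V.pr_map W f.toAddMonoidHom k hf
  obtain ⟨x0, hx0⟩ := hne
  constructor
  · have h1 : V.IsGrSub f.toAddMonoidHom.ker := by
      rw [isGrSub_iff]
      refine ⟨⟨?_, ?_⟩, ?_⟩
      · intro s x hx
        have hx : f x = 0 := hx
        change f (s • x) = 0
        rw [map_smul, hx, smul_zero]
      · intro s x hx
        have hx : f x = 0 := hx
        change f (s • x) = 0
        rw [hH, hx, smul_zero]
      · intro x hx i
        have hx : f x = 0 := hx
        have := hpr i x
        change f (V.pr i x) = 0
        rw [LinearMap.toAddMonoidHom_coe] at this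
        rw [← this, hx, map_zero]
    rcases hV.2 _ h1 with h | h
    · exact (AddMonoidHom.ker_eq_bot_iff _).mp h
    · exfalso
      apply hx0
      have : x0 ∈ f.toAddMonoidHom.ker := by rw [h]; trivial
      exact this
  · have h1 : W.IsGrSub f.toAddMonoidHom.range := by
      rw [isGrSub_iff]
      refine ⟨⟨?_, ?_⟩, ?_⟩
      · rintro s _ ⟨x, rfl⟩
        exact ⟨s • x, map_smul f s x⟩
      · rintro s _ ⟨x, rfl⟩
        exact ⟨s • x, hH s x⟩
      · rintro _ ⟨x, rfl⟩ i
        refine ⟨V.pr (i - k) x, ?_⟩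
        rw [← hpr, sub_add_cancel]
    rcases hW.2 _ h1 with h | h
    · exfalso
      apply hx0
      have : f x0 ∈ f.toAddMonoidHom.range := ⟨x0, rfl⟩
      rw [h] at this
      exact this
    · intro y
      have : y ∈ f.toAddMonoidHom.range := by rw [h]; trivial
      exact this

/-- Graded simple modules are simple. -/
theorem GrSimple.simple [DirectSum.Decomposition 𝒜] {V : GrMod A H 𝒜 F} (hV : V.GrSimple) :
    V.forget.Simple := by
  rw [simple_iff]
  refine ⟨hV.1, ?_⟩
  intro p hp
  by_cases hbot : p = ⊥
  · exact Or.inl hbot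
  right
  -- the degree `i` part of the leading-term module
  let lead : ℤ → AddSubgroup V.carrier := fun i =>
    { carrier := {y | ∃ t ∈ p, (∀ j, i < j → V.pr j t = 0) ∧ V.pr i t = y}
      add_mem' := by
        rintro _ _ ⟨t, ht, h1, rfl⟩ ⟨t', ht', h1', rfl⟩
        refine ⟨t + t', p.add_mem ht ht', ?_, map_add _ _ _⟩
        intro j hj
        rw [map_add, h1 j hj, h1' j hj, add_zero]
      zero_mem' := ⟨0, p.zero_mem, fun j _ => map_zero _, map_zero _⟩
      neg_mem' := by
        rintro _ ⟨t, ht, h1, rfl⟩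
        refine ⟨-t, p.neg_mem ht, ?_, map_neg _ _⟩
        intro j hj
        rw [map_neg, h1 j hj, neg_zero] }
  have lead_smulH : ∀ d (h : H), h ∈ 𝒜 d → ∀ i, ∀ y ∈ lead i, h • y ∈ lead (i + d) := by
    rintro d h hh i _ ⟨t, ht, h1, rfl⟩
    refine ⟨h • t, hp.2 h t ht, ?_, V.pr_smul hh i t⟩
    intro j hj
    have := V.pr_smul hh (j - d) t
    rw [sub_add_cancel] at this
    rw [this, h1 _ (by omega), smul_zero]
  let P : AddSubgroup V.carrier :=
    { carrier := {y | ∀ i, V.pr i y ∈ lead i}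
      add_mem' := by
        intro x y hx hy i
        rw [map_add]
        exact (lead i).add_mem (hx i) (hy i)
      zero_mem' := by
        intro i
        rw [map_zero]
        exact (lead i).zero_mem
      neg_mem' := by
        intro x hx i
        rw [map_neg]
        exact (lead i).neg_mem (hx i) }
  have hP : V.IsGrSub P := by
    rw [isGrSub_iff]
    refine ⟨⟨?_, ?_⟩, ?_⟩
    · intro s x hx i
      obtain ⟨t, ht, h1, h2⟩ := hx i
      refine ⟨s • t, hp.1 s t ht, ?_, ?_⟩
      · intro j hj
        rw [map_smul, h1 j hj, smul_zero]
      · rw [map_smul, map_smul, h2]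
    · intro h
      induction h using DirectSum.Decomposition.inductionOn 𝒜 with
      | zero =>
        intro x hx
        have : (0 : H) • x = 0 := zero_smul _ _
        rw [this]
        exact P.zero_mem
      | @homogeneous d h =>
        intro x hx i
        have := V.pr_smul h.2 (i - d) x
        rw [sub_add_cancel] at this
        change V.pr i ((h : H) • x) ∈ lead i
        rw [this]
        have h5 := lead_smulH d h h.2 (i - d) _ (hx (i - d))
        rwa [sub_add_cancel] at h5
      | add h h' ih ih' =>
        intro x hx
        have : (h + h') • x = h • x + h' • x := add_smul _ _ _
        rw [this]
        exact P.add_mem (ih x hx) (ih' x hx)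
    · intro x hx i
      change ∀ j, V.pr j (V.pr i x) ∈ lead j
      intro j
      by_cases hj : i = j
      · subst hj
        rw [V.pr_same (V.pr_mem i x)]
        exact hx i
      · rw [V.pr_ne (V.pr_mem i x) hj]
        exact (lead j).zero_mem
  have hPbot : P ≠ ⊥ := by
    intro hPb
    obtain ⟨⟨t, ht⟩, ht0'⟩ := AddSubgroup.ne_bot_iff_exists_ne_zero.mp hbot
    have ht0 : t ≠ 0 := fun h0 => ht0' (Subtype.ext h0)
    obtain ⟨i0, hi0⟩ := V.exists_pr_ne_zero ht0
    have hfin : {i | V.pr i t ≠ 0}.Finite := V.finite_degrees.subset (by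
      intro i hi
      rw [Set.mem_ofPred_eq, Submodule.ne_bot_iff]
      exact ⟨_, V.pr_mem i t, hi⟩)
    have hne : hfin.toFinset.Nonempty := ⟨i0, by simpa using hi0⟩
    have hm := Finset.max'_mem _ hne
    set m := hfin.toFinset.max' hne with hmdef
    rw [Set.Finite.mem_toFinset, Set.mem_ofPred_eq] at hm
    have : V.pr m t ∈ P := by
      intro j
      by_cases hj : m = j
      · subst hj
        rw [V.pr_same (V.pr_mem _ t)]
        refine ⟨t, ht, ?_, rfl⟩
        intro j hj
        by_contra hcon
        have := Finset.le_max' hfin.toFinset j (by simpa using hcon)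
        omega
      · rw [V.pr_ne (V.pr_mem _ t) hj]
        exact (lead j).zero_mem
    rw [hPb] at this
    exact hm this
  have hPtop := (hV.2 P hP).resolve_left hPbot
  -- by induction on the degree all homogeneous elements lie in `p`
  obtain ⟨lo, hlo⟩ : ∃ lo : ℤ, ∀ i, i < lo → V.grading i = ⊥ := by
    obtain ⟨lo, hlo⟩ := V.finite_degrees.bddBelow
    refine ⟨lo, fun i hi => ?_⟩
    by_contra hcon
    have := hlo hcon
    omega
  have hfil : ∀ n : ℕ, ∀ x : V.carrier, (∀ j, lo + n ≤ j → V.pr j x = 0) → x ∈ p := by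
    intro n
    induction n with
    | zero =>
      intro x hx
      have : x = 0 := by
        apply V.ext_pr
        intro i
        rw [map_zero]
        by_cases hi : i < lo
        · have := V.pr_mem i x
          rw [hlo i hi] at this
          exact this
        · exact hx i (by simp; omega)
      rw [this]
      exact p.zero_mem
    | succ n ih =>
      intro x hx
      have hxP : x ∈ P := by rw [hPtop]; trivial
      obtain ⟨t, ht, h1, h2⟩ := hxP (lo + n)
      have : x - t ∈ p := by
        apply ih
        intro j hj
        rcases hj.eq_or_lt with h | h
        · rw [← h, map_sub, h2, sub_self]
        · rw [map_sub, h1 j h, hx j (by push_cast; omega), sub_self]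
      have := p.add_mem this ht
      rwa [sub_add_cancel] at this
  rw [eq_top_iff]
  intro x _
  obtain ⟨hi, hhi⟩ := V.finite_degrees.bddAbove
  refine hfil (hi + 1 - lo).toNat x ?_
  intro j hj
  by_contra hcon
  have : j ≤ hi := hhi (by
    rw [Set.mem_ofPred_eq, Submodule.ne_bot_iff]
    exact ⟨_, V.pr_mem j x, hcon⟩)
  have := Int.self_le_toNat (hi + 1 - lo)
  omega

theorem grSimple_of_simple {V : GrMod A H 𝒜 F} (hV : V.forget.Simple) : V.GrSimple :=
  ⟨hV.1, fun p hp => hV.2 p hp.1⟩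

/-- An ungraded nonzero homomorphism between graded simple modules yields a shift. -/
theorem exists_shift [DirectSum.Decomposition 𝒜] {V W : GrMod A H 𝒜 F} (hV : V.GrSimple)
    (hW : W.GrSimple)
    (f : V.carrier →ₗ[F] W.carrier) (hH : ∀ (h : H) x, f (h • x) = h • f x)
    (hne : ∃ x, f x ≠ 0) : ∃ k, V.IsShiftOf W k := by
  let fk : ℤ → (V.carrier →ₗ[F] W.carrier) := fun k =>
    (DirectSum.toModule F ℤ W.carrier
      (fun i => W.pr (i + k) ∘ₗ f ∘ₗ (V.grading i).subtype)) ∘ₗ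
      (DirectSum.decomposeLinearEquiv V.grading).toLinearMap
  have hfk : ∀ k i, ∀ x ∈ V.grading i, fk k x = W.pr (i + k) (f x) := by
    intro k i x hx
    have : DirectSum.decomposeLinearEquiv V.grading x =
        DirectSum.lof F ℤ (fun i => V.grading i) i ⟨x, hx⟩ := DirectSum.decompose_of_mem _ hx
    simp only [fk, LinearMap.comp_apply, LinearEquiv.coe_coe]
    rw [this, DirectSum.toModule_lof]
    rfl
  have hfkd : ∀ k i, ∀ x ∈ V.grading i, fk k x ∈ W.grading (i + k) := by
    intro k i x hx
    rw [hfk k i x hx]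
    exact W.pr_mem _ _
  have hfkH : ∀ k (h : H) x, fk k (h • x) = h • fk k x := by
    intro k h
    induction h using DirectSum.Decomposition.inductionOn 𝒜 with
    | zero => simp
    | @homogeneous d h =>
      intro x
      induction x using V.homog_induction with
      | zero => simp
      | homogeneous i x hx =>
        rw [hfk k i x hx, hfk k _ _ (V.grading_smul d i h h.2 x hx), hH,
          show d + i + k = (i + k) + d by ring, W.pr_smul h.2]
      | add x y hx hy => simp only [smul_add, map_add, hx, hy]
    | add h h' ih ih' =>
      intro x
      simp only [add_smul, map_add, ih, ih']
  obtain ⟨k, hk⟩ : ∃ k, ∃ x, fk k x ≠ 0 := by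
    by_contra hcon
    push Not at hcon
    obtain ⟨x, hx⟩ := hne
    apply hx
    clear hx
    induction x using V.homog_induction with
    | zero => simp
    | homogeneous i x hx =>
      apply W.ext_pr
      intro j
      have := hcon (j - i) x
      rw [hfk _ i x hx, add_sub_cancel] at this
      rw [this, map_zero]
    | add x y hx hy => rw [map_add, hx, hy, add_zero]
  have hb := bijective_of_homog hV hW (fk k) (hfkH k) k (hfkd k) hk
  refine ⟨-k, AddEquiv.ofBijective (fk k) hb, ?_, ?_, ?_⟩
  · intro s x
    exact map_smul (fk k) s x
  · exact hfkH k
  · intro i x hx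
    rw [sub_neg_eq_add]
    exact hfkd k i x hx

/-- The degree zero endomorphism on graded pieces is preserved by shifts. -/
theorem IsShiftOf.cpoly_eq {V W : GrMod A H 𝒜 F} {k : ℤ} (h : V.IsShiftOf W k)
    (a : 𝒜 0) (i : ℤ) : V.cpoly a i = W.cpoly a (i - k) := by
  obtain ⟨e, h1, h2, h3⟩ := h
  let el : V.carrier →ₗ[F] W.carrier := { e.toAddMonoidHom with map_smul' := h1 }
  let r : V.grading i →ₗ[F] W.grading (i - k) := el.restrict (fun x hx => h3 i x hx)
  have hr : Bijective r := by
    constructor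
    · intro x y hxy
      apply Subtype.ext
      apply e.injective
      exact congrArg Subtype.val hxy
    · rintro ⟨y, hy⟩
      refine ⟨⟨e.symm y, ?_⟩, ?_⟩
      · refine V.mem_of_map_mem W e.toAddMonoidHom (-k) e.injective h3 _ _ ?_
        simpa [sub_eq_add_neg] using hy
      · apply Subtype.ext
        exact e.apply_symm_apply y
  refine charpoly_equiv_aux (LinearEquiv.ofBijective r hr) _ _ ?_
  intro x
  apply Subtype.ext
  exact h2 a x

end GrMod

end GradedField


section Factors

variable {A : Type u} [CommRing A] {H : Type u} [Ring H] [Algebra A H]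
  {𝒜 : ℤ → Submodule A H} {F : Type u} [Field F] [Algebra A F]

namespace GrMod

/-- The action of `h` as an `F`-linear map. -/
def actL (V : GrMod A H 𝒜 F) (h : H) : V.carrier →ₗ[F] V.carrier where
  toFun x := h • x
  map_add' x y := smul_add h x y
  map_smul' s x := V.smul_comm' h s x

/-- The grading submodules on a graded module criterion. -/
theorem isInternal_of_proj {Z : Type u} [AddCommGroup Z] [Module F Z] (G : ℤ → Submodule F Z)
    (δ : ℤ → Z →ₗ[F] Z) (h1 : ∀ i, ∀ x ∈ G i, δ i x = x)
    (h2 : ∀ i j, i ≠ j → ∀ x ∈ G i, δ j x = 0)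
    (h3 : ∀ z : Z, z ∈ ⨆ i, G i) : DirectSum.IsInternal G := by
  have key : ∀ (v : ⨁ i, G i) (i : ℤ), δ i (DirectSum.coeAddMonoidHom G v) = v i := by
    intro v i
    induction v using DirectSum.induction_on with
    | zero => simp
    | of j x =>
      rw [DirectSum.coeAddMonoidHom_of]
      by_cases hj : j = i
      · subst hj
        rw [h1 _ _ x.2, DirectSum.of_eq_same]
      · rw [h2 _ _ hj _ x.2, DirectSum.of_eq_of_ne _ _ _ (Ne.symm hj)]
        rfl
    | add x y hx hy => simp only [map_add, hx, hy, DirectSum.add_apply, Submodule.coe_add]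
  constructor
  · intro v w hvw
    apply DFinsupp.ext
    intro i
    apply Subtype.ext
    exact (key v i).symm.trans ((congrArg (δ i) hvw).trans (key w i))
  · intro z
    have hz := h3 z
    induction hz using Submodule.iSup_induction' with
    | mem i x hx => exact ⟨DirectSum.of (fun i => G i) i ⟨x, hx⟩, DirectSum.coeAddMonoidHom_of _ _ _⟩
    | zero => exact ⟨0, map_zero _⟩
    | add x y _ _ hx hy =>
      obtain ⟨a, rfl⟩ := hx
      obtain ⟨b, rfl⟩ := hy
      exact ⟨a + b, map_add _ _ _⟩

theorem exists_factor (V : GrMod A H 𝒜 F) (p q : AddSubgroup V.carrier)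
    (hp : V.IsGrSub p) (hq : V.IsGrSub q) :
    ∃ Q : GrMod A H 𝒜 F, V.IsFactorShift p q Q 0 := by
  rw [isGrSub_iff] at hp hq
  let q' : Submodule F V.carrier := V.stableSub q hq.1
  let p' : Submodule F V.carrier := V.stableSub p hp.1
  let p'' : Submodule F q' := p'.comap q'.subtype
  let aq : H → (q' →ₗ[F] q') := fun h => (V.actL h).restrict (fun x hx => hq.1.2 h x hx)
  have haq : ∀ h, p'' ≤ p''.comap (aq h) := fun h x hx => hp.1.2 h x hx
  let ρ : H →+* Module.End F (q' ⧸ p'') :=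
    { toFun := fun h => p''.mapQ p'' (aq h) (haq h)
      map_one' := by
        ext x
        have : aq 1 x = x := Subtype.ext (one_smul H (x : V.carrier))
        simp [this]
      map_mul' := by
        intro h k
        ext x
        have : aq (h * k) x = aq h (aq k x) := Subtype.ext (mul_smul h k (x : V.carrier))
        simp [this]
      map_zero' := by
        ext x
        have : aq 0 x = 0 := Subtype.ext (zero_smul H (x : V.carrier))
        simp [this]
      map_add' := by
        intro h k
        ext x
        have : aq (h + k) x = aq h x + aq k x := Subtype.ext (add_smul h k (x : V.carrier))
        simp [this] }
  let modH : Module H (q' ⧸ p'') := Module.compHom _ ρ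
  have hsm : ∀ (h : H) (x : q'), h • (p''.mkQ x) = p''.mkQ (aq h x) := fun h x => rfl
  let G : ℤ → Submodule F (q' ⧸ p'') := fun i => ((V.grading i).comap q'.subtype).map p''.mkQ
  let prq : ℤ → (q' →ₗ[F] q') := fun i => (V.pr i).restrict (fun x hx => hq.2 x hx i)
  have hprq : ∀ i, p'' ≤ p''.comap (prq i) := fun i x hx => hp.2 _ hx i
  let δ : ℤ → ((q' ⧸ p'') →ₗ[F] (q' ⧸ p'')) := fun i => p''.mapQ p'' (prq i) (hprq i)
  have hIntl : DirectSum.IsInternal G := by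
    refine isInternal_of_proj G δ ?_ ?_ ?_
    · rintro i _ ⟨x, hx, rfl⟩
      have : prq i x = x := Subtype.ext (V.pr_same hx)
      simp only [δ, Submodule.mkQ_apply, Submodule.mapQ_apply, this]
    · rintro i j hij _ ⟨x, hx, rfl⟩
      have : prq j x = 0 := Subtype.ext (V.pr_ne hx hij)
      simp only [δ, Submodule.mkQ_apply, Submodule.mapQ_apply, this, Submodule.Quotient.mk_zero]
    · intro z
      obtain ⟨x, rfl⟩ := p''.mkQ_surjective z
      obtain ⟨s, hs⟩ := V.exists_sum_pr x
      have : x = ∑ i ∈ s, prq i x := by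
        apply Subtype.ext
        rw [Submodule.coe_sum]
        exact hs.symm
      rw [this, map_sum]
      refine Submodule.sum_mem _ fun i _ => ?_
      exact Submodule.mem_iSup_of_mem i ⟨prq i x, V.pr_mem i x, rfl⟩
  let dec : DirectSum.Decomposition G := hIntl.chooseDecomposition
  let Q : GrMod A H 𝒜 F :=
    { carrier := q' ⧸ p''
      modH := modH
      smul_comm' := by
        intro h s x
        exact map_smul (ρ h) s x
      compat := by
        intro a x
        obtain ⟨x, rfl⟩ := p''.mkQ_surjective x
        rw [hsm, ← map_smul]
        congr 1
        apply Subtype.ext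
        exact V.compat a x
      grading := G
      decomp := dec
      grading_smul := by
        rintro i j h hh _ ⟨x, hx, rfl⟩
        exact ⟨aq h x, V.grading_smul i j h hh _ hx, rfl⟩ }
  refine ⟨Q, (p''.mkQ.toAddMonoidHom : q' →+ (q' ⧸ p'')), ?_, ?_, ?_, ?_, ?_, ?_⟩
  · exact p''.mkQ_surjective
  · intro x
    exact Submodule.Quotient.mk_eq_zero p'' (x := (⟨x.1, x.2⟩ : q'))
  · intro s x y hxy
    let x' : q' := ⟨x.1, x.2⟩
    let y' : q' := ⟨y.1, y.2⟩
    have : y' = s • x' := Subtype.ext hxy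
    change p''.mkQ y' = s • p''.mkQ x'
    rw [this, map_smul]
  · intro h x y hxy
    let x' : q' := ⟨x.1, x.2⟩
    let y' : q' := ⟨y.1, y.2⟩
    have : y' = aq h x' := Subtype.ext hxy
    change p''.mkQ y' = p''.mkQ (aq h x')
    rw [this]
  · intro i x hx
    rw [sub_zero]
    exact ⟨x, hx, rfl⟩
  · intro i m hm
    rw [sub_zero] at hm
    obtain ⟨x, hx, rfl⟩ := hm
    exact ⟨x, hx, rfl⟩

/-- Factoring through an isomorphism of subquotients. -/
theorem isFactorShift_iff (V : GrMod A H 𝒜 F) {p q : AddSubgroup V.carrier}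
    (hq : V.IsGrSub q)
    {Q M : GrMod A H 𝒜 F} (hQ : V.IsFactorShift p q Q 0) (n : ℤ) :
    V.IsFactorShift p q M n ↔ Q.IsShiftOf M n := by
  obtain ⟨ψ, s1, k1, a1, b1, c1, d1⟩ := hQ
  rw [isGrSub_iff] at hq
  have hψker : ∀ x y : q, ψ x = ψ y ↔ (x : V.carrier) - y ∈ p := by
    intro x y
    rw [← sub_eq_zero, ← map_sub, k1]
    rfl
  constructor
  · rintro ⟨φ, s2, k2, a2, b2, c2, d2⟩
    have hφker : ∀ x y : q, φ x = φ y ↔ (x : V.carrier) - y ∈ p := by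
      intro x y
      rw [← sub_eq_zero, ← map_sub, k2]
      rfl
    have hkk : ψ.ker = φ.ker := by
      ext x
      rw [AddMonoidHom.mem_ker, AddMonoidHom.mem_ker, k1, k2]
    let e : Q.carrier ≃+ M.carrier :=
      (QuotientAddGroup.quotientKerEquivOfSurjective ψ s1).symm.trans
        ((QuotientAddGroup.quotientAddEquivOfEq hkk).trans
          (QuotientAddGroup.quotientKerEquivOfSurjective φ s2))
    have he : ∀ x, e (ψ x) = φ x := by
      intro x
      have h0 : (QuotientAddGroup.quotientKerEquivOfSurjective ψ s1).symm (ψ x) =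
          (x : q ⧸ ψ.ker) := by
        rw [AddEquiv.symm_apply_eq]
        rfl
      simp only [e, AddEquiv.trans_apply, h0]
      rfl
    refine ⟨e, ?_, ?_, ?_⟩
    · intro s z
      obtain ⟨x, rfl⟩ := s1 z
      rw [← a1 s x ⟨s • (x : V.carrier), hq.1.1 s x x.2⟩ rfl, he, he]
      exact a2 s x _ rfl
    · intro s z
      obtain ⟨x, rfl⟩ := s1 z
      rw [← b1 s x ⟨s • (x : V.carrier), hq.1.2 s x x.2⟩ rfl, he, he]
      exact b2 s x _ rfl
    · intro i z hz
      obtain ⟨x, hx, rfl⟩ := d1 i z (by rwa [sub_zero])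
      rw [he]
      exact c2 i x hx
  · rintro ⟨e, h1, h2, h3⟩
    refine ⟨e.toAddMonoidHom.comp ψ, e.surjective.comp s1, ?_, ?_, ?_, ?_, ?_⟩
    · intro x
      rw [← k1]
      exact e.map_eq_zero_iff
    · intro s x y hxy
      change e (ψ y) = s • e (ψ x)
      rw [a1 s x y hxy, h1]
    · intro s x y hxy
      change e (ψ y) = s • e (ψ x)
      rw [b1 s x y hxy, h2]
    · intro i x hx
      have := c1 i x hx
      rw [sub_zero] at this
      exact h3 i _ this
    · intro i m hm
      have : e.symm m ∈ Q.grading i := by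
        refine Q.mem_of_map_mem M e.toAddMonoidHom (-n) e.injective h3 _ _ ?_
        simpa [sub_eq_add_neg] using hm
      obtain ⟨x, hx, hx'⟩ := d1 i _ (by rw [sub_zero]; exact this)
      refine ⟨x, hx, ?_⟩
      change e (ψ x) = m
      rw [hx', e.apply_symm_apply]

/-- Factors of graded composition series are graded simple. -/
theorem factor_simple (V : GrMod A H 𝒜 F) {p q : AddSubgroup V.carrier}
    (hp : V.IsGrSub p) (hq : V.IsGrSub q) (hpq : p ≤ q) (hne : p ≠ q)
    (hstep : ∀ r : AddSubgroup V.carrier, V.IsGrSub r → p ≤ r → r ≤ q → r = p ∨ r = q)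
    {Q : GrMod A H 𝒜 F} (hQ : V.IsFactorShift p q Q 0) : Q.GrSimple := by
  obtain ⟨ψ, s1, k1, a1, b1, c1, d1⟩ := hQ
  rw [isGrSub_iff] at hq hp
  have hpr : ∀ (x : q) (i : ℤ), ψ ⟨V.pr i x, hq.2 x x.2 i⟩ = Q.pr i (ψ x) := by
    intro x i
    obtain ⟨s, hs⟩ := V.exists_sum_pr x
    have h1 : x = ∑ j ∈ s, (⟨V.pr j x, hq.2 x x.2 j⟩ : q) := by
      apply Subtype.ext
      rw [AddSubgroup.val_finsetSum]
      exact hs.symm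
    have h2 : ∀ j, ψ ⟨V.pr j x, hq.2 x x.2 j⟩ ∈ Q.grading j := by
      intro j
      have := c1 j ⟨V.pr j x, hq.2 x x.2 j⟩ (V.pr_mem j x)
      rwa [sub_zero] at this
    conv_rhs => rw [h1, map_sum, map_sum]
    by_cases hi : i ∈ s
    · rw [Finset.sum_eq_single i]
      · rw [Q.pr_same (h2 i)]
      · intro j _ hj
        exact Q.pr_ne (h2 j) hj
      · intro h
        exact absurd hi h
    · rw [Finset.sum_eq_zero]
      · have h3 : V.pr i x = 0 := by
          rw [← hs, map_sum]
          refine Finset.sum_eq_zero fun j hj => V.pr_ne (V.pr_mem j x) ?_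
          rintro rfl
          exact hi hj
        have h4 : (⟨V.pr i x, hq.2 x x.2 i⟩ : q) = 0 := Subtype.ext h3
        rw [h4, map_zero]
      · intro j hj
        refine Q.pr_ne (h2 j) ?_
        rintro rfl
        exact hi hj
  constructor
  · obtain ⟨x, hx, hxp⟩ := SetLike.exists_of_lt (lt_of_le_of_ne hpq hne)
    refine ⟨ψ ⟨x, hx⟩, 0, ?_⟩
    intro h0
    exact hxp ((k1 _).mp h0)
  · intro T hT
    rw [isGrSub_iff] at hT
    let r : AddSubgroup V.carrier := (T.comap ψ).map q.subtype
    have hmem : ∀ x : q, (x : V.carrier) ∈ r ↔ ψ x ∈ T := by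
      intro x
      constructor
      · rintro ⟨y, hy, hxy⟩
        have : y = x := Subtype.ext hxy
        rw [← this]
        exact hy
      · intro hx
        exact ⟨x, hx, rfl⟩
    have hrq : r ≤ q := by
      rintro _ ⟨y, hy, rfl⟩
      exact y.2
    have hr : V.IsGrSub r := by
      rw [isGrSub_iff]
      refine ⟨⟨?_, ?_⟩, ?_⟩
      · rintro s x hx
        have hxq := hrq hx
        refine (hmem ⟨s • x, hq.1.1 s x hxq⟩).mpr ?_
        rw [a1 s ⟨x, hxq⟩ _ rfl]
        exact hT.1.1 s _ ((hmem ⟨x, hxq⟩).mp hx)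
      · rintro s x hx
        have hxq := hrq hx
        refine (hmem ⟨s • x, hq.1.2 s x hxq⟩).mpr ?_
        rw [b1 s ⟨x, hxq⟩ _ rfl]
        exact hT.1.2 s _ ((hmem ⟨x, hxq⟩).mp hx)
      · intro x hx i
        have hxq := hrq hx
        refine (hmem ⟨V.pr i x, hq.2 x hxq i⟩).mpr ?_
        rw [hpr ⟨x, hxq⟩ i]
        exact hT.2 _ ((hmem ⟨x, hxq⟩).mp hx) i
    have hpr' : p ≤ r := by
      intro x hx
      refine (hmem ⟨x, hpq hx⟩).mpr ?_
      rw [(k1 ⟨x, hpq hx⟩).mpr hx]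
      exact T.zero_mem
    rcases hstep r hr hpr' hrq with h | h
    · left
      rw [eq_bot_iff]
      intro z hz
      obtain ⟨x, rfl⟩ := s1 z
      have : (x : V.carrier) ∈ r := (hmem x).mpr hz
      rw [h] at this
      rw [(k1 x).mpr this]
      exact AddSubgroup.zero_mem _
    · right
      rw [eq_top_iff]
      intro z _
      obtain ⟨x, rfl⟩ := s1 z
      apply (hmem x).mp
      rw [h]
      exact x.2

/-- Multiplicativity of characteristic polynomials along a graded composition series. -/
theorem cpoly_eq_prod (V : GrMod A H 𝒜 F) (cs : GrCompSeries V)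
    (M : Fin cs.len → GrMod A H 𝒜 F) (n : Fin cs.len → ℤ)
    (hM : ∀ t, V.IsFactorShift (cs.c t.castSucc) (cs.c t.succ) (M t) (n t))
    (h : 𝒜 0) (i : ℤ) :
    V.cpoly h i = ∏ t, (M t).cpoly h (i - n t) := by
  have hg : ∀ t, V.Stab (cs.c t) := fun t => (cs.graded t).1
  choose ψ s1 k1 a1 b1 c1 d1 using hM
  let P : Fin (cs.len + 1) → Submodule F (V.grading i) := fun t =>
    (V.stableSub (cs.c t) (hg t)).comap (V.grading i).subtype
  let j : ∀ t, P t → cs.c t := fun t x => ⟨((x : V.grading i) : V.carrier), x.2⟩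
  have hinv : ∀ t, P t ≤ (P t).comap (V.degAct h i) := fun t x hx => (hg t).2 h _ hx
  refine charpoly_chain_aux (V.degAct h i) cs.len P hinv ?_ ?_ ?_
    (fun t => (M t).grading (i - n t)) (fun t => (M t).degAct h (i - n t))
    (fun t => { toFun := fun x => ⟨ψ t (j t.succ x), c1 t i _ x.1.2⟩
                map_add' := fun x y => Subtype.ext (map_add (ψ t) (j _ x) (j _ y))
                map_smul' := fun s x => Subtype.ext (a1 t s (j _ x) (j _ (s • x)) rfl) })
    ?_ ?_ ?_
  · intro t x hx
    exact cs.mono t hx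
  · rw [eq_bot_iff]
    intro x hx
    have hx : (x : V.carrier) ∈ cs.c 0 := hx
    rw [cs.bot] at hx
    exact Subtype.ext hx
  · rw [eq_top_iff]
    intro x _
    change (x : V.carrier) ∈ cs.c (Fin.last _)
    rw [cs.top]
    trivial
  · rintro t ⟨y, hy⟩
    obtain ⟨x, hx, hxy⟩ := d1 t i y hy
    exact ⟨⟨⟨x, hx⟩, x.2⟩, Subtype.ext hxy⟩
  · intro t x
    refine Iff.trans ?_ (k1 t (j _ x))
    exact Subtype.ext_iff
  · intro t x
    apply Subtype.ext
    exact b1 t h (j _ x) _ rfl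

end GrMod

end Factors


section Reduction

variable {A : Type u} [CommRing A] {H : Type u} [Ring H] [Algebra A H]
  {𝒜 : ℤ → Submodule A H} {F : Type u} [Field F] [Algebra A F]

namespace GrMod

/-- The degree `i` part of a lattice, over the valuation ring. -/
def latPiece (V : GrMod A H 𝒜 F) (O : ValuationSubring F) (L : AddSubgroup V.carrier)
    (hL : V.IsLattice O L) (i : ℤ) : Submodule O V.carrier where
  carrier := {x | x ∈ L ∧ x ∈ V.grading i}
  add_mem' := fun ha hb => ⟨L.add_mem ha.1 hb.1, Submodule.add_mem _ ha.2 hb.2⟩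
  zero_mem' := ⟨L.zero_mem, Submodule.zero_mem _⟩
  smul_mem' := fun c _ hx => ⟨hL.1 c c.2 _ hx.1, Submodule.smul_mem _ (c : F) hx.2⟩

theorem latPiece_finite (V : GrMod A H 𝒜 F) (O : ValuationSubring F) (L : AddSubgroup V.carrier)
    (hL : V.IsLattice O L) (i : ℤ) : Module.Finite O (V.latPiece O L hL i) := by
  obtain ⟨h1, h2, h3, n, b, hb1, hb2, hb3, hb4⟩ := id hL
  have hspan : V.latPiece O L hL i = Submodule.span O (Set.range fun m => V.pr i (b m)) := by
    apply le_antisymm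
    · rintro x ⟨hxL, hxi⟩
      obtain ⟨c, hc, hx⟩ := hb4 x hxL
      rw [← V.pr_same hxi, hx, map_sum]
      refine Submodule.sum_mem _ fun m _ => ?_
      rw [map_smul]
      exact Submodule.smul_mem _ (⟨c m, hc m⟩ : O) (Submodule.subset_span ⟨m, rfl⟩)
    · rw [Submodule.span_le]
      rintro _ ⟨m, rfl⟩
      exact ⟨h3 _ (hb3 m) i, V.pr_mem i _⟩
  rw [hspan]
  exact Module.Finite.span_of_finite O (Set.finite_range _)

theorem latPiece_free (V : GrMod A H 𝒜 F) (O : ValuationSubring F) (L : AddSubgroup V.carrier)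
    (hL : V.IsLattice O L) (i : ℤ) : Module.Free O (V.latPiece O L hL i) := by
  have := V.latPiece_finite O L hL i
  have : Module.Flat O (V.latPiece O L hL i) := by
    rw [Module.Flat.flat_iff_torsion_eq_bot_of_isBezout, eq_bot_iff]
    rintro x ⟨⟨a, ha⟩, hax⟩
    have h1 : (a : F) • (x : V.carrier) = 0 := congrArg Subtype.val hax
    have h2 : (a : F) ≠ 0 := by
      intro h
      exact nonZeroDivisors.ne_zero ha (Subtype.ext h)
    rw [smul_eq_zero] at h1
    exact Subtype.ext (h1.resolve_left h2)
  exact Module.free_of_flat_of_isLocalRing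

theorem reduces_cpoly {k : Type u} [Field k] [Algebra A k] (V : GrMod A H 𝒜 F)
    (O : ValuationSubring F) (π : O →+* k) (hπs : Surjective π)
    (hπ : ∀ o : O, π o = 0 ↔ ¬ IsUnit o)
    (L : AddSubgroup V.carrier) (hL : V.IsLattice O L)
    (Y : GrMod A H 𝒜 k) (φ : L →+ Y.carrier) (hY : GrMod.Reduces O π V L Y φ)
    (h : 𝒜 0) (i : ℤ) :
    ∃ P : Polynomial O, P.map O.subtype = V.cpoly h i ∧ P.map π = Y.cpoly h i := by
  classical
  have hfin := V.latPiece_finite O L hL i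
  have hfree := V.latPiece_free O L hL i
  obtain ⟨h1, h2, h3, n, b, hb1, hb2, hb3, hb4⟩ := id hL
  obtain ⟨φs, φk, φc, φh, φg, φg'⟩ := hY
  set Li := V.latPiece O L hL i with hLi
  let β := Module.Free.chooseBasis O Li
  -- basis of the degree `i` piece of `V`
  let bF : Module.Free.ChooseBasisIndex O Li → V.grading i := fun j => ⟨β j, (β j).2.2⟩
  have hliF : LinearIndependent F bF := by
    have e1 : LinearIndependent O (fun j => ((β j : Li) : V.carrier)) :=
      β.linearIndependent.map' Li.subtype Li.ker_subtype
    rw [LinearIndependent.iff_fractionRing O F] at e1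
    exact LinearIndependent.of_comp (V.grading i).subtype e1
  have hspF : ⊤ ≤ Submodule.span F (Set.range bF) := by
    have key : ∀ x ∈ Li, ∃ c : Module.Free.ChooseBasisIndex O Li → F,
        x = ∑ j, c j • (bF j : V.carrier) := by
      intro x hx
      refine ⟨fun j => (β.repr ⟨x, hx⟩ j : F), ?_⟩
      have := congrArg Subtype.val (β.sum_repr ⟨x, hx⟩)
      rw [Submodule.coe_sum] at this
      exact this.symm
    rintro ⟨x, hx⟩ -
    have : x ∈ Submodule.span F (Set.range fun j => (bF j : V.carrier)) := by
      have hxb : x ∈ Submodule.span F (Set.range b) := hb2 ▸ Submodule.mem_top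
      have : V.pr i x ∈ (Submodule.span F (Set.range b)).map (V.pr i) := ⟨x, hxb, rfl⟩
      rw [V.pr_same hx, Submodule.map_span] at this
      refine Submodule.span_le.mpr ?_ this
      rintro _ ⟨_, ⟨m, rfl⟩, rfl⟩
      obtain ⟨c, hc⟩ := key (V.pr i (b m)) ⟨h3 _ (hb3 m) i, V.pr_mem i _⟩
      rw [hc]
      exact Submodule.sum_mem _ fun j _ => Submodule.smul_mem _ _ (Submodule.subset_span ⟨j, rfl⟩)
    have e2 : (Set.range fun j => (bF j : V.carrier)) = (V.grading i).subtype '' Set.range bF := by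
      rw [← Set.range_comp]; rfl
    rw [e2, ← Submodule.map_span] at this
    obtain ⟨y, hy, hyx⟩ := this
    have : y = ⟨x, hx⟩ := Subtype.ext hyx
    exact this ▸ hy
  let BF := Module.Basis.mk hliF hspF
  have hBF : ∀ j, BF j = bF j := fun j => Module.Basis.mk_apply _ _ _
  -- basis of the degree `i` piece of `Y`
  let φi : Li →+ Y.grading i :=
    { toFun := fun x => ⟨φ ⟨x, x.2.1⟩, φg i _ x.2.2⟩
      map_zero' := Subtype.ext (map_zero φ)
      map_add' := fun x y => Subtype.ext (map_add φ ⟨x, x.2.1⟩ ⟨y, y.2.1⟩) }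
  have hφi : ∀ (c : O) (x : Li), φi (c • x) = π c • φi x := fun c x =>
    Subtype.ext (φc c ⟨x, x.2.1⟩ ⟨_, (c • x).2.1⟩ rfl)
  let bk : Module.Free.ChooseBasisIndex O Li → Y.grading i := fun j => φi (β j)
  have hφsum : ∀ c : Module.Free.ChooseBasisIndex O Li → O,
      φi (∑ j, c j • β j) = ∑ j, π (c j) • bk j := by
    intro c
    rw [map_sum]
    exact Finset.sum_congr rfl fun j _ => hφi _ _
  -- coordinates
  have hcoord : ∀ (x : Li) j, BF.repr ⟨x, x.2.2⟩ j = ((β.repr x j : O) : F) := by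
    intro x j
    have : (⟨x, x.2.2⟩ : V.grading i) = ∑ j, ((β.repr x j : O) : F) • BF j := by
      apply Subtype.ext
      rw [Submodule.coe_sum]
      have := congrArg Subtype.val (β.sum_repr x)
      rw [Submodule.coe_sum] at this
      simp only [hBF]
      exact this.symm
    rw [this]
    exact congrFun (BF.repr_sum_self (fun j => ((β.repr x j : O) : F))) j
  have hms : ∀ z ∈ GrMod.mSub O V L, ∀ j, ∃ o : O, o ∈ IsLocalRing.maximalIdeal O ∧
      (o : F) = BF.repr ⟨V.pr i z, V.pr_mem i z⟩ j := by
    intro z hz j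
    let cof : V.carrier →ₗ[F] F :=
      BF.coord j ∘ₗ LinearMap.codRestrict (V.grading i) (V.pr i) (V.pr_mem i)
    change ∃ o : O, o ∈ IsLocalRing.maximalIdeal O ∧ (o : F) = cof z
    unfold GrMod.mSub at hz
    induction hz using AddSubgroup.closure_induction with
    | mem z hz =>
      obtain ⟨c, hc, y, hy, rfl⟩ := hz
      refine ⟨c * β.repr ⟨V.pr i y, h3 y hy i, V.pr_mem i y⟩ j,
        Ideal.mul_mem_right _ _ ((IsLocalRing.mem_maximalIdeal _).mpr hc), ?_⟩
      rw [map_smul]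
      have := hcoord ⟨V.pr i y, h3 y hy i, V.pr_mem i y⟩ j
      change _ = (c : F) * BF.repr ⟨V.pr i y, V.pr_mem i y⟩ j
      rw [this]
      rfl
    | zero => exact ⟨0, Ideal.zero_mem _, by rw [map_zero]; rfl⟩
    | add x y _ _ hx hy =>
      obtain ⟨o, ho, e⟩ := hx
      obtain ⟨o', ho', e'⟩ := hy
      exact ⟨o + o', Ideal.add_mem _ ho ho', by rw [map_add, ← e, ← e']; rfl⟩
    | neg x _ hx =>
      obtain ⟨o, ho, e⟩ := hx
      exact ⟨-o, (Ideal.neg_mem_iff _).mpr ho, by rw [map_neg, ← e]; rfl⟩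
  have hlik : LinearIndependent k bk := by
    rw [Fintype.linearIndependent_iff]
    intro a ha j
    choose c hc using fun j => hπs (a j)
    have e1 : φi (∑ j, c j • β j) = 0 := by
      rw [hφsum]
      simp only [hc]
      exact ha
    set x := ∑ j, c j • β j with hx
    have e2 : (x : V.carrier) ∈ GrMod.mSub O V L :=
      (φk ⟨x, x.2.1⟩).mp (congrArg Subtype.val e1)
    obtain ⟨o, ho, e3⟩ := hms _ e2 j
    have e4 : (⟨V.pr i x, V.pr_mem i x⟩ : V.grading i) = ⟨x, x.2.2⟩ :=
      Subtype.ext (V.pr_same x.2.2)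
    rw [e4, hcoord] at e3
    have e5 : β.repr x j = c j := by
      rw [hx, β.repr_sum_self]
    rw [e5] at e3
    have e6 : o = c j := Subtype.ext e3
    rw [← hc, hπ, ← e6]
    exact (IsLocalRing.mem_maximalIdeal _).mp ho
  have hspk : ⊤ ≤ Submodule.span k (Set.range bk) := by
    rintro ⟨y, hy⟩ -
    obtain ⟨x, hx, hxy⟩ := φg' i y hy
    let x' : Li := ⟨x, x.2, hx⟩
    have : (⟨y, hy⟩ : Y.grading i) = φi x' := Subtype.ext hxy.symm
    rw [this, ← β.sum_repr x', hφsum]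
    exact Submodule.sum_mem _ fun j _ => Submodule.smul_mem _ _ (Submodule.subset_span ⟨j, rfl⟩)
  let Bk := Module.Basis.mk hlik hspk
  have hBk : ∀ j, Bk j = bk j := fun j => Module.Basis.mk_apply _ _ _
  -- the action
  let f : Li →ₗ[O] Li :=
    { toFun := fun x => ⟨(h : H) • (x : V.carrier), h2 _ _ x.2.1, by
        simpa using V.grading_smul 0 i (h : H) h.2 (x : V.carrier) x.2.2⟩
      map_add' := fun x y => Subtype.ext (smul_add (h : H) (x : V.carrier) y)
      map_smul' := fun c x => Subtype.ext (V.smul_comm' (h : H) (c : F) x) }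
  let mt := LinearMap.toMatrix β β f
  have hmt : ∀ a c, mt a c = β.repr (f (β c)) a := fun a c => LinearMap.toMatrix_apply _ _ _ _ _
  refine ⟨mt.charpoly, ?_, ?_⟩
  · have : mt.map O.subtype = LinearMap.toMatrix BF BF (V.degAct h i) := by
      ext a c
      rw [Matrix.map_apply, hmt, LinearMap.toMatrix_apply, hBF]
      exact (hcoord (f (β c)) a).symm
    rw [← Matrix.charpoly_map, this, LinearMap.charpoly_toMatrix]
    rfl
  · have : mt.map π = LinearMap.toMatrix Bk Bk (Y.degAct h i) := by
      ext a c
      rw [Matrix.map_apply, hmt, LinearMap.toMatrix_apply, hBk]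
      have e1 : Y.degAct h i (bk c) = φi (f (β c)) := by
        apply Subtype.ext
        exact (φh (h : H) ⟨β c, (β c).2.1⟩ ⟨f (β c), (f (β c)).2.1⟩ rfl).symm
      rw [e1]
      conv_rhs => rw [← β.sum_repr (f (β c)), hφsum]
      simp only [← hBk]
      exact (congrFun (Bk.repr_sum_self (fun j => π (β.repr (f (β c)) j))) a).symm
    rw [← Matrix.charpoly_map, this, LinearMap.charpoly_toMatrix]
    rfl

end GrMod
end Reduction


section Integrality

variable {A : Type u} [CommRing A] {H : Type u} [Ring H] [Algebra A H]
  {𝒜 : ℤ → Submodule A H}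

namespace GrMod

theorem aeval_degAct {F : Type u} [Field F] [Algebra A F] (V : GrMod A H 𝒜 F)
    (h : 𝒜 0) (i : ℤ) (p : Polynomial A)
    (x : V.grading i) :
    ((Polynomial.aeval (V.degAct h i) (p.map (algebraMap A F)) x : V.grading i) : V.carrier)
      = (Polynomial.aeval (h : H) p) • (x : V.carrier) := by
  induction p using Polynomial.induction_on' with
  | add p q hp hq => simp [hp, hq, add_smul]
  | monomial n a =>
    have hpow : ∀ n : ℕ, (((V.degAct h i) ^ n) x : V.grading i) = ((h : H) ^ n) • (x : V.carrier) := by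
      intro n
      induction n with
      | zero => simp
      | succ n ih =>
        rw [pow_succ', pow_succ', mul_smul, ← ih]
        rfl
    rw [Polynomial.map_monomial, Polynomial.aeval_monomial, Polynomial.aeval_monomial, mul_smul,
      ← hpow, V.compat]
    rfl

theorem cpoly_integral [IsDomain A] [IsIntegrallyClosed A] {K : Type u} [Field K] [Algebra A K]
    [IsFractionRing A K] [Module.Finite A H] (V : GrMod A H 𝒜 K) (h : 𝒜 0) (i : ℤ) :
    ∃ c : Polynomial A, c.map (algebraMap A K) = V.cpoly h i := by
  obtain ⟨p, hp, hp0⟩ := Algebra.IsIntegral.isIntegral (R := A) (h : H)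
  refine charpoly_integral_aux (V.degAct h i) p hp ?_
  ext x
  rw [aeval_degAct, Polynomial.aeval_def, hp0]
  simp

theorem reduces_map {F k : Type u} [Field F] [Algebra A F]
    [Field k] [Algebra A k] (V : GrMod A H 𝒜 F)
    (O : ValuationSubring F) (hAO : ∀ a : A, algebraMap A F a ∈ O)
    (π : O →+* k) (hπs : Surjective π)
    (hπ : ∀ o : O, π o = 0 ↔ ¬ IsUnit o)
    (hπA : ∀ a : A, π ⟨algebraMap A F a, hAO a⟩ = algebraMap A k a)
    (L : AddSubgroup V.carrier) (hL : V.IsLattice O L)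
    (Y : GrMod A H 𝒜 k) (φ : L →+ Y.carrier) (hY : GrMod.Reduces O π V L Y φ)
    (h : 𝒜 0) (i : ℤ) (c : Polynomial A) (hc : c.map (algebraMap A F) = V.cpoly h i) :
    c.map (algebraMap A k) = Y.cpoly h i := by
  obtain ⟨P, hP1, hP2⟩ := V.reduces_cpoly O π hπs hπ L hL Y φ hY h i
  let ι : A →+* O := (algebraMap A F).codRestrict O hAO
  have e1 : O.subtype.comp ι = algebraMap A F := rfl
  have e2 : π.comp ι = algebraMap A k := RingHom.ext hπA
  have e3 : c.map ι = P := by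
    apply Polynomial.map_injective O.subtype Subtype.val_injective
    rw [Polynomial.map_map, e1, hc, hP1]
  rw [← hP2, ← e3, Polynomial.map_map, e2]

end GrMod
end Integrality


section Separation

open TensorProduct

variable {A : Type u} [CommRing A] {H : Type u} [Ring H] [Algebra A H]
  {𝒜 : ℤ → Submodule A H} {F : Type u} [Field F] [Algebra A F]

theorem isSemisimpleModule_prod_aux {R M N : Type*} [Ring R] [AddCommGroup M] [Module R M]
    [AddCommGroup N] [Module R N] [IsSemisimpleModule R M] [IsSemisimpleModule R N] :
    IsSemisimpleModule R (M × N) := by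
  have h1 : IsSemisimpleModule R (LinearMap.range (LinearMap.inl R M N)) := .range _
  have h2 : IsSemisimpleModule R (LinearMap.range (LinearMap.inr R M N)) := .range _
  have h3 := IsSemisimpleModule.sup h1 h2
  rw [LinearMap.sup_range_inl_inr] at h3
  exact IsSemisimpleModule.congr (Submodule.topEquiv (R := R) (M := M × N)).symm

theorem tensor_clear_denom (hfrac : ∀ x : F, ∃ a b : A,
      algebraMap A F b ≠ 0 ∧ x * algebraMap A F b = algebraMap A F a)
    (r : F ⊗[A] H) : ∃ (b : A) (h : H), algebraMap A F b ≠ 0 ∧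
      (algebraMap A F b ⊗ₜ[A] (1 : H)) * r = (1 : F) ⊗ₜ[A] h := by
  have key : ∀ (a : A) (h : H), (algebraMap A F a) ⊗ₜ[A] h = (1 : F) ⊗ₜ[A] (a • h) := by
    intro a h
    rw [TensorProduct.tmul_smul, TensorProduct.smul_tmul', Algebra.smul_def, mul_one]
  induction r using TensorProduct.induction_on with
  | zero => exact ⟨1, 0, by simp, by simp⟩
  | tmul s h =>
    obtain ⟨a, b, hb, e⟩ := hfrac s
    refine ⟨b, a • h, hb, ?_⟩
    rw [Algebra.TensorProduct.tmul_mul_tmul, one_mul, mul_comm, e, key]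
  | add x y hx hy =>
    obtain ⟨b, h, hb, e⟩ := hx
    obtain ⟨b', h', hb', e'⟩ := hy
    refine ⟨b * b', b' • h + b • h', ?_, ?_⟩
    · rw [map_mul]
      exact mul_ne_zero hb hb'
    · have e1 : (algebraMap A F (b * b') ⊗ₜ[A] (1 : H)) =
          (algebraMap A F b' ⊗ₜ[A] (1 : H)) * (algebraMap A F b ⊗ₜ[A] (1 : H)) := by
        rw [Algebra.TensorProduct.tmul_mul_tmul, one_mul, map_mul, mul_comm]
      have e2 : (algebraMap A F (b * b') ⊗ₜ[A] (1 : H)) =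
          (algebraMap A F b ⊗ₜ[A] (1 : H)) * (algebraMap A F b' ⊗ₜ[A] (1 : H)) := by
        rw [Algebra.TensorProduct.tmul_mul_tmul, one_mul, map_mul]
      rw [mul_add]
      conv_lhs => 
        congr
        · rw [e1, mul_assoc, e]
        · rw [e2, mul_assoc, e']
      rw [Algebra.TensorProduct.tmul_mul_tmul, Algebra.TensorProduct.tmul_mul_tmul, mul_one,
        mul_one, one_mul, one_mul, key, key, TensorProduct.tmul_add]

namespace GrMod

/-- The module over the tensor product algebra attached to a graded module. -/
@[reducible] noncomputable def tmod (V : GrMod A H 𝒜 F) : Module (F ⊗[A] H) V.carrier :=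
  letI m : Module A V.carrier := Module.compHom V.carrier (algebraMap A F)
  haveI : IsScalarTower A F V.carrier := ⟨fun a s x => by
    rw [Algebra.smul_def, mul_smul]; rfl⟩
  haveI : IsScalarTower A H V.carrier := ⟨fun a s x => by
    rw [Algebra.smul_def, mul_smul, V.compat]; rfl⟩
  haveI : SMulCommClass F H V.carrier := ⟨fun s h x => (V.smul_comm' h s x).symm⟩
  TensorProduct.Algebra.module

theorem tmod_smul (V : GrMod A H 𝒜 F) (s : F) (h : H) (x : V.carrier) :
    letI := V.tmod
    (s ⊗ₜ[A] h : F ⊗[A] H) • x = s • h • x := rfl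

theorem tmod_simple (V : GrMod A H 𝒜 F) (hV : V.forget.Simple) :
    letI := V.tmod
    IsSimpleModule (F ⊗[A] H) V.carrier := by
  let _ := V.tmod
  rw [simple_iff] at hV
  obtain ⟨hnt, hs⟩ := hV
  rw [isSimpleModule_iff]
  refine { toNontrivial := (Submodule.nontrivial_iff _).mpr hnt, eq_bot_or_eq_top := ?_ }
  intro p
  have hst : V.Stab p.toAddSubgroup := by
    refine ⟨?_, ?_⟩
    · intro s x hx
      have := p.smul_mem (s ⊗ₜ[A] (1 : H)) hx
      rw [V.tmod_smul, one_smul] at this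
      exact this
    · intro h x hx
      have := p.smul_mem ((1 : F) ⊗ₜ[A] h) hx
      rw [V.tmod_smul, one_smul] at this
      exact this
  rcases hs p.toAddSubgroup hst with h | h
  · left
    rw [eq_bot_iff]
    intro x hx
    have : x ∈ p.toAddSubgroup := hx
    rw [h] at this
    exact this
  · right
    rw [eq_top_iff]
    intro x _
    have : x ∈ p.toAddSubgroup := by
      rw [h]
      trivial
    exact this

theorem deg0_smul [DirectSum.Decomposition 𝒜] (V : GrMod A H 𝒜 F) (h : H) {i : ℤ}
    {x : V.carrier} (hx : x ∈ V.grading i) :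
    ((DirectSum.decompose 𝒜 h 0 : 𝒜 0) : H) • x = V.pr i (h • x) := by
  induction h using DirectSum.Decomposition.inductionOn 𝒜 with
  | zero => simp
  | @homogeneous d m =>
    have hm := V.grading_smul d i m m.2 x hx
    by_cases hd : d = 0
    · subst hd
      rw [DirectSum.decompose_coe, DirectSum.of_eq_same]
      rw [zero_add] at hm
      rw [V.pr_same hm]
    · rw [DirectSum.decompose_coe, DirectSum.of_eq_of_ne _ _ _ (Ne.symm hd), V.pr_ne hm (by omega)]
      simp
  | add m m' h1 h2 =>
    rw [DirectSum.decompose_add, DirectSum.add_apply, Submodule.coe_add, add_smul, h1, h2,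
      add_smul, map_add]

end GrMod
end Separation


section Separation2

open TensorProduct

variable {A : Type u} [CommRing A] {H : Type u} [Ring H] [Algebra A H]
  {𝒜 : ℤ → Submodule A H} {F : Type u} [Field F] [Algebra A F]

namespace GrMod

theorem separation_aux [DirectSum.Decomposition 𝒜]
    (hfrac : ∀ x : F, ∃ a b : A, algebraMap A F b ≠ 0 ∧ x * algebraMap A F b = algebraMap A F a)
    (hsplit : SplitAlg A H F) (M : GrMod A H 𝒜 F) (hM : M.forget.Simple)
    {ι : Type} [Finite ι] (S : ι → GrMod A H 𝒜 F) (hS : ∀ s, (S s).GrSimple)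
    (hne : ∀ s, ¬ ∃ k, (S s).IsShiftOf M k) (i0 : ℤ) :
    ∃ (h : H) (b : F), b ≠ 0 ∧ (∀ x : M.carrier, h • x = b • M.pr i0 x) ∧
      ∀ s, ∀ x : (S s).carrier, h • x = 0 := by
  classical
  have := Fintype.ofFinite ι
  let _ : Module (F ⊗[A] H) M.carrier := M.tmod
  let _ : ∀ s, Module (F ⊗[A] H) (S s).carrier := fun s => (S s).tmod
  have hM1 : IsSimpleModule (F ⊗[A] H) M.carrier := M.tmod_simple hM
  have hS1 : ∀ s, IsSimpleModule (F ⊗[A] H) (S s).carrier := fun s =>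
    (S s).tmod_simple (hS s).simple
  have hss : IsSemisimpleModule (F ⊗[A] H) (M.carrier × Π s, (S s).carrier) :=
    isSemisimpleModule_prod_aux
  have hMg := grSimple_of_simple hM
  -- homs
  have tS : ∀ {V : GrMod A H 𝒜 F} (s : F) (x : V.carrier),
      (letI := V.tmod; (s ⊗ₜ[A] (1 : H) : F ⊗[A] H) • x) = s • x := by
    intro V s x
    rw [V.tmod_smul, one_smul]
  have tH : ∀ {V : GrMod A H 𝒜 F} (h : H) (x : V.carrier),
      (letI := V.tmod; ((1 : F) ⊗ₜ[A] h : F ⊗[A] H) • x) = h • x := by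
    intro V s x
    rw [V.tmod_smul, one_smul]
  have hz1 : ∀ s (f : M.carrier →ₗ[F ⊗[A] H] (S s).carrier) x, f x = 0 := by
    intro s f x
    by_contra hx
    let f' : M.carrier →ₗ[F] (S s).carrier :=
      { f.toAddMonoidHom with
        map_smul' := fun c x => by
          have := f.map_smul (c ⊗ₜ[A] (1 : H)) x
          rwa [tS, tS] at this }
    obtain ⟨k, hk⟩ := exists_shift hMg (hS s) f' (fun h x => by
          have := f.map_smul ((1 : F) ⊗ₜ[A] h) x
          rwa [tH, tH] at this) ⟨x, hx⟩
    exact hne s ⟨_, hk.symm⟩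
  have hz2 : ∀ s (f : (S s).carrier →ₗ[F ⊗[A] H] M.carrier) x, f x = 0 := by
    intro s f x
    by_contra hx
    let f' : (S s).carrier →ₗ[F] M.carrier :=
      { f.toAddMonoidHom with
        map_smul' := fun c x => by
          have := f.map_smul (c ⊗ₜ[A] (1 : H)) x
          rwa [tS, tS] at this }
    obtain ⟨k, hk⟩ := exists_shift (hS s) hMg f' (fun h x => by
          have := f.map_smul ((1 : F) ⊗ₜ[A] h) x
          rwa [tH, tH] at this) ⟨x, hx⟩
    exact hne s ⟨_, hk⟩
  have hz3 : ∀ (f : M.carrier →ₗ[F ⊗[A] H] M.carrier), ∃ c : F, ∀ x, f x = c • x := by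
    intro f
    have q1 : ∀ (c : F) (x : M.carrier), f (c • x) = c • f x := fun c x => by
      have := f.map_smul (c ⊗ₜ[A] (1 : H)) x
      rwa [tS, tS] at this
    have q2 : ∀ (h : H) (x : M.carrier), f (h • x) = h • f x := fun h x => by
      have := f.map_smul ((1 : F) ⊗ₜ[A] h) x
      rwa [tH, tH] at this
    exact hsplit M.forget hM f.toAddMonoidHom q1 q2
  let f : Module.End (Module.End (F ⊗[A] H) (M.carrier × Π s, (S s).carrier))
      (M.carrier × Π s, (S s).carrier) :=
    { toFun := fun x => (M.pr i0 x.1, 0)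
      map_add' := fun x y => by simp
      map_smul' := by
        intro g x
        obtain ⟨c, hc⟩ := hz3 (LinearMap.fst _ _ _ ∘ₗ g ∘ₗ LinearMap.inl _ _ _)
        have hc' : ∀ x, g (x, 0) = (c • x, 0) := by
          intro x
          refine Prod.ext (hc x) ?_
          funext s
          exact hz1 s (LinearMap.proj s ∘ₗ LinearMap.snd _ _ _ ∘ₗ g ∘ₗ LinearMap.inl _ _ _) x
        have hy : ∀ y, (g (0, y)).1 = 0 := by
          intro y
          have e1 : y = ∑ s, Pi.single s (y s) := (Finset.univ_sum_single y).symm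
          have e2 : (LinearMap.fst _ _ _ ∘ₗ g ∘ₗ LinearMap.inr (F ⊗[A] H) M.carrier
            (Π s, (S s).carrier)) y = 0 := by
            rw [e1, map_sum]
            refine Finset.sum_eq_zero fun s _ => ?_
            exact hz2 s ((LinearMap.fst _ _ _ ∘ₗ g ∘ₗ LinearMap.inr (F ⊗[A] H) M.carrier
              (Π s, (S s).carrier)) ∘ₗ LinearMap.single (F ⊗[A] H) (fun s => (S s).carrier) s) (y s)
          exact e2
        obtain ⟨x, y⟩ := x
        have e3 : g (x, y) = g (x, 0) + g (0, y) := by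
          rw [← map_add]; simp
        change (M.pr i0 (g (x, y)).1, 0) = g (M.pr i0 x, 0)
        rw [hc', e3, hc', Prod.fst_add, hy, add_zero, map_smul] }
  obtain ⟨T, hT⟩ := Module.Finite.fg_top (R := F) (M := M.carrier × Π s, (S s).carrier)
  obtain ⟨r, hr⟩ := jacobson_density f T
  obtain ⟨b, h, hb, e⟩ := tensor_clear_denom hfrac r
  have key : ∀ x : M.carrier × Π s, (S s).carrier,
      h • x.1 = algebraMap A F b • M.pr i0 x.1 ∧ ∀ s, h • x.2 s = 0 := by
    intro x
    have hx : x ∈ Submodule.span F (T : Set (M.carrier × Π s, (S s).carrier)) :=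
      hT ▸ Submodule.mem_top
    induction hx using Submodule.span_induction with
    | mem x hx =>
      have e1 : ((1 : F) ⊗ₜ[A] h) • x = (algebraMap A F b ⊗ₜ[A] (1 : H)) • f x := by
        rw [← e, mul_smul, hr x hx]
      constructor
      · have := congrArg Prod.fst e1
        rw [Prod.smul_fst, Prod.smul_fst, tH, tS] at this
        exact this
      · intro s
        have := congrFun (congrArg Prod.snd e1) s
        rw [Prod.smul_snd, Prod.smul_snd, Pi.smul_apply, Pi.smul_apply, tH, tS] at this
        rw [this]
        exact smul_zero _
    | zero => simp
    | add x y _ _ hx hy =>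
      refine ⟨?_, fun s => ?_⟩
      · rw [Prod.fst_add, smul_add, hx.1, hy.1, map_add, smul_add]
      · rw [Prod.snd_add, Pi.add_apply, smul_add, hx.2, hy.2, add_zero]
    | smul c x _ hx =>
      refine ⟨?_, fun s => ?_⟩
      · rw [Prod.smul_fst, M.smul_comm', hx.1, map_smul, smul_comm]
      · rw [Prod.smul_snd, Pi.smul_apply, (S s).smul_comm', hx.2, smul_zero]
  refine ⟨h, algebraMap A F b, hb, fun x => (key (x, 0)).1, fun s x => ?_⟩
  have := (key (0, Pi.single s x)).2 s
  simpa using this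

theorem separation [DirectSum.Decomposition 𝒜]
    (hfrac : ∀ x : F, ∃ a b : A, algebraMap A F b ≠ 0 ∧ x * algebraMap A F b = algebraMap A F a)
    (hsplit : SplitAlg A H F) (M : GrMod A H 𝒜 F) (hM : M.forget.Simple)
    {ι : Type} [Finite ι] (S : ι → GrMod A H 𝒜 F) (hS : ∀ s, (S s).GrSimple) (i0 : ℤ) :
    ∃ (h : 𝒜 0) (b : F), b ≠ 0 ∧ (∀ x : M.carrier, (h : H) • x = b • M.pr i0 x) ∧
      ∀ s, (¬ ∃ k, (S s).IsShiftOf M k) → ∀ x : (S s).carrier, (h : H) • x = 0 := by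
  obtain ⟨h, b, hb, h1, h2⟩ := separation_aux hfrac hsplit M hM
    (fun s : {s // ¬ ∃ k, (S s).IsShiftOf M k} => S s.1) (fun s => hS s.1) (fun s => s.2) i0
  refine ⟨DirectSum.decompose 𝒜 h 0, b, hb, ?_, ?_⟩
  · intro x
    induction x using M.homog_induction with
    | zero => simp
    | homogeneous i x hx =>
      rw [M.deg0_smul h hx, h1, map_smul]
      by_cases hi : i = i0
      · subst hi
        rw [M.pr_same hx, M.pr_same hx]
      · rw [M.pr_ne hx hi, map_zero]
    | add x y hx hy => rw [smul_add, hx, hy, map_add, smul_add]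
  · intro s hs x
    induction x using (S s).homog_induction with
    | zero => simp
    | homogeneous i x hx =>
      rw [(S s).deg0_smul h hx, h2 ⟨s, hs⟩, map_zero]
    | add x y hx hy => rw [smul_add, hx, hy, add_zero]

end GrMod
end Separation2


section Roots

variable {A : Type u} [CommRing A] {H : Type u} [Ring H] [Algebra A H]
  {𝒜 : ℤ → Submodule A H} {F : Type u} [Field F] [Algebra A F]

theorem charpoly_scalar_aux {k U : Type*} [Field k] [AddCommGroup U] [Module k U]
    [Module.Finite k U] (f : U →ₗ[k] U) (c : k) (hf : ∀ x, f x = c • x) :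
    f.charpoly = (Polynomial.X - Polynomial.C c) ^ Module.finrank k U := by
  have h1 : LinearMap.toMatrix (Module.finBasis k U) (Module.finBasis k U) f =
      Matrix.diagonal fun _ => c := by
    have : f = c • LinearMap.id := LinearMap.ext hf
    rw [this, map_smul, LinearMap.toMatrix_id, Matrix.smul_one_eq_diagonal]
  rw [← LinearMap.charpoly_toMatrix f (Module.finBasis k U), h1, Matrix.charpoly_diagonal]
  simp

theorem T_coeff_aux (m n : ℤ) :
    (LaurentPolynomial.T m : LaurentPolynomial ℕ).coeff n = if m = n then 1 else 0 := by
  change (AddMonoidAlgebra.single m (1 : ℕ)).coeff n = _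
  rw [AddMonoidAlgebra.coeff_single, Finsupp.single_apply]

theorem mul_T_coeff_aux (x : LaurentPolynomial ℕ) (m n : ℤ) :
    (x * LaurentPolynomial.T m).coeff n = x.coeff (n - m) := by
  change (x * AddMonoidAlgebra.single m (1 : ℕ)).coeff n = _
  rw [AddMonoidAlgebra.coeff_mul_single_apply, mul_one, sub_eq_add_neg]

theorem rootMultiplicity_prod_aux {k ι : Type*} [Field k] (s : Finset ι) (p : ι → Polynomial k)
    (hp : ∀ t ∈ s, p t ≠ 0) (b : k) :
    (∏ t ∈ s, p t).rootMultiplicity b = ∑ t ∈ s, (p t).rootMultiplicity b := by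
  classical
  induction s using Finset.induction_on with
  | empty => simp
  | insert a s ha ih =>
    have h1 : ∀ t ∈ s, p t ≠ 0 := fun t ht => hp t (Finset.mem_insert_of_mem ht)
    rw [Finset.prod_insert ha, Finset.sum_insert ha, Polynomial.rootMultiplicity_mul, ih h1]
    exact mul_ne_zero (hp a (Finset.mem_insert_self _ _)) (Finset.prod_ne_zero_iff.mpr h1)

namespace GrMod

theorem cpoly_ne_zero (V : GrMod A H 𝒜 F) (h : 𝒜 0) (i : ℤ) : V.cpoly h i ≠ 0 :=
  (LinearMap.charpoly_monic _).ne_zero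

open Classical in
theorem rootMult_simple (M S : GrMod A H 𝒜 F) (hS : Nontrivial S.carrier) (i0 : ℤ) (h : 𝒜 0)
    (b : F) (hb : b ≠ 0) (hM : ∀ x : M.carrier, (h : H) • x = b • M.pr i0 x)
    (hk : (¬ ∃ k, S.IsShiftOf M k) → ∀ x : S.carrier, (h : H) • x = 0) (i : ℤ) :
    (S.cpoly h i).rootMultiplicity b =
      if S.IsShiftOf M (i - i0) then Module.finrank F (M.grading i0) else 0 := by
  have hzero : ∀ n, (((Polynomial.X : Polynomial F) - Polynomial.C 0) ^ n).rootMultiplicity b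
      = 0 := by
    intro n
    apply Polynomial.rootMultiplicity_eq_zero
    simp [Polynomial.IsRoot, hb]
  by_cases hex : ∃ k, S.IsShiftOf M k
  · obtain ⟨k, hk'⟩ := hex
    rw [hk'.cpoly_eq]
    by_cases hi : i - k = i0
    · have : i - i0 = k := by omega
      rw [this, if_pos hk', hi]
      unfold cpoly
      rw [charpoly_scalar_aux (M.degAct h i0) b, Polynomial.rootMultiplicity_X_sub_C_pow]
      intro x
      apply Subtype.ext
      change (h : H) • (x : M.carrier) = b • (x : M.carrier)
      rw [hM, M.pr_same x.2]
    · have : ¬ S.IsShiftOf M (i - i0) := by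
        intro hcon
        have := hk'.unique hS hcon
        omega
      rw [if_neg this]
      unfold cpoly
      rw [charpoly_scalar_aux (M.degAct h (i - k)) 0, hzero]
      intro x
      apply Subtype.ext
      change (h : H) • (x : M.carrier) = (0 : F) • (x : M.carrier)
      rw [hM, M.pr_ne x.2 hi, smul_zero, zero_smul]
  · rw [if_neg (fun hc => hex ⟨_, hc⟩)]
    unfold cpoly
    rw [charpoly_scalar_aux (S.degAct h i) 0, hzero]
    intro x
    apply Subtype.ext
    change (h : H) • (x : S.carrier) = (0 : F) • (x : S.carrier)
    rw [hk hex, zero_smul]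

theorem rootMult_multShift (M : GrMod A H 𝒜 F) (i0 : ℤ) (h : 𝒜 0)
    (b : F) (hb : b ≠ 0) (hM : ∀ x : M.carrier, (h : H) • x = b • M.pr i0 x)
    (Y : GrMod A H 𝒜 F) (cs : GrCompSeries Y) (Q : Fin cs.len → GrMod A H 𝒜 F)
    (hQ : ∀ t, Y.IsFactorShift (cs.c t.castSucc) (cs.c t.succ) (Q t) 0)
    (hQs : ∀ t, (Q t).GrSimple)
    (hk : ∀ t, (¬ ∃ k, (Q t).IsShiftOf M k) → ∀ x : (Q t).carrier, (h : H) • x = 0) (n : ℤ) :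
    (Y.cpoly h (i0 + n)).rootMultiplicity b =
      Y.multShift cs M n * Module.finrank F (M.grading i0) := by
  classical
  rw [Y.cpoly_eq_prod cs Q (fun _ => 0) hQ,
    rootMultiplicity_prod_aux _ _ (fun t _ => cpoly_ne_zero _ _ _)]
  have e1 : Y.multShift cs M n = ∑ t, if (Q t).IsShiftOf M n then 1 else 0 := by
    unfold multShift
    rw [Nat.card_eq_fintype_card, Fintype.card_subtype, Finset.card_filter]
    refine Finset.sum_congr rfl fun t _ => ?_
    rw [Y.isFactorShift_iff (cs.graded _) (hQ t)]
  rw [e1, Finset.sum_mul]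
  refine Finset.sum_congr rfl fun t _ => ?_
  rw [rootMult_simple M (Q t) (hQs t).1 i0 h b hb hM (hk t)]
  have : i0 + n - 0 - i0 = n := by omega
  rw [this]
  split_ifs <;> simp

/-- Choice of factors of a composition series. -/
theorem exists_factors (Y : GrMod A H 𝒜 F) (cs : GrCompSeries Y) :
    ∃ Q : Fin cs.len → GrMod A H 𝒜 F,
      (∀ t, Y.IsFactorShift (cs.c t.castSucc) (cs.c t.succ) (Q t) 0) ∧ ∀ t, (Q t).GrSimple := by
  choose Q hQ using fun t : Fin cs.len =>
    Y.exists_factor (cs.c t.castSucc) (cs.c t.succ) (cs.graded _) (cs.graded _)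
  exact ⟨Q, hQ, fun t => Y.factor_simple (cs.graded _) (cs.graded _) (cs.mono t) (cs.steps t).1
    (cs.steps t).2 (hQ t)⟩

/-- Coefficients of the graded decomposition numbers. -/
theorem entryPoly_coeff (Y : GrMod A H 𝒜 F) (cs : GrCompSeries Y) (M : GrMod A H 𝒜 F) (n : ℤ) :
    (Y.entryPoly cs M).coeff n = Y.multShift cs M n := by
  classical
  obtain ⟨Q, hQ, hQs⟩ := Y.exists_factors cs
  have hfin : (Function.support fun n : ℤ => Y.multShift cs M n).Finite := by
    have hf : (⋃ t : Fin cs.len, {n : ℤ | (Q t).IsShiftOf M n}).Finite := by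
      refine Set.finite_iUnion fun t => Set.Subsingleton.finite ?_
      intro j hj k hk
      exact IsShiftOf.unique (hQs t).1 hj hk
    refine hf.subset ?_
    intro n hn
    rw [Function.mem_support] at hn
    unfold multShift at hn
    have := (Nat.card_ne_zero.mp hn).1
    obtain ⟨t, ht⟩ := this
    rw [Y.isFactorShift_iff (cs.graded _) (hQ t)] at ht
    exact Set.mem_iUnion.mpr ⟨t, ht⟩
  unfold entryPoly
  rw [finsum_eq_sum_of_support_subset (s := hfin.toFinset)]
  · rw [AddMonoidAlgebra.coeff_sum, Finsupp.finsetSum_apply]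
    rw [Finset.sum_eq_single n]
    · rw [AddMonoidAlgebra.coeff_smul, Finsupp.smul_apply, T_coeff_aux, if_pos rfl, smul_eq_mul,
        mul_one]
    · intro m _ hm
      rw [AddMonoidAlgebra.coeff_smul, Finsupp.smul_apply, T_coeff_aux, if_neg hm, smul_zero]
    · intro hn
      rw [Set.Finite.mem_toFinset, Function.mem_support, not_not] at hn
      rw [hn, zero_smul]
      rfl
  · intro m hm
    rw [Set.Finite.coe_toFinset]
    intro h0
    apply hm
    simp only at h0 ⊢
    rw [h0, zero_smul]

end GrMod
end Roots

/-- factorization of graded decomposition matrices.  In the setting of the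
factorization theorem for graded decomposition maps (with the residue fields of the chosen
valuation rings realized as `L`, resp. `L'`), the entries of the graded decomposition
matrices, i.e. the Laurent polynomials `∑_n q^n [kṼ : M⟨n⟩]^gr ∈ ℕ[q,q⁻¹]` computed from
graded composition series of the modular reductions, satisfy
`D^gr_{θ'}(q) = D^gr_{θ,θ'}(q) · D^gr_θ(q)` entrywise: for every simple graded `KH`-module
`V` and simple graded `L'H`-module `M`,
`D^gr_{θ'}(V,M) = ∑_N D^gr_{θ,θ'}(N,M) · D^gr_θ(V,N)`, the sum being over a complete
irredundant family `N` of simple `LH`-modules. -/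
theorem factorization_graded_decomposition_matrices
    (A : Type u) [CommRing A] [IsDomain A] [IsIntegrallyClosed A]
    (K : Type u) [Field K] [Algebra A K] [IsFractionRing A K]
    (H : Type u) [Ring H] [Algebra A H] [Module.Free A H] [Module.Finite A H]
    (𝒜 : ℤ → Submodule A H) [GradedAlgebra 𝒜]
    (L : Type u) [Field L] [Algebra A L]
    (L' : Type u) [Field L'] [Algebra A L']
    (hLfrac : ∀ x : L, ∃ a b : A,
      algebraMap A L b ≠ 0 ∧ x * algebraMap A L b = algebraMap A L a)
    (hL'frac : ∀ x : L', ∃ a b : A,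
      algebraMap A L' b ≠ 0 ∧ x * algebraMap A L' b = algebraMap A L' a)
    (hker : ∀ a : A, algebraMap A L a = 0 → algebraMap A L' a = 0)
    (B : Subring L) (hθB : ∀ a : A, algebraMap A L a ∈ B)
    (φ : B →+* L') (hφθ : ∀ a : A, φ ⟨algebraMap A L a, hθB a⟩ = algebraMap A L' a)
    (hBclosed : ∀ x : L,
      (∃ p : Polynomial B, p.Monic ∧ Polynomial.eval₂ B.subtype x p = 0) → x ∈ B)
    (hsplitL : SplitAlg A H L) (hsplitL' : SplitAlg A H L')
    -- valuation ring for θ : A → L inside K, with residue field realized as L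
    (O : ValuationSubring K) (hAO : ∀ a : A, algebraMap A K a ∈ O)
    (π : O →+* L) (hπsurj : Function.Surjective π)
    (hπker : ∀ o : O, π o = 0 ↔ ¬ IsUnit o)
    (hπA : ∀ a : A, π ⟨algebraMap A K a, hAO a⟩ = algebraMap A L a)
    -- valuation ring for θ' : A → L' inside K, with residue field realized as L'
    (O' : ValuationSubring K) (hAO' : ∀ a : A, algebraMap A K a ∈ O')
    (π' : O' →+* L') (hπ'surj : Function.Surjective π')
    (hπ'ker : ∀ o : O', π' o = 0 ↔ ¬ IsUnit o)
    (hπ'A : ∀ a : A, π' ⟨algebraMap A K a, hAO' a⟩ = algebraMap A L' a)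
    -- valuation ring for φ : B → L' inside L, with residue field realized as L'
    (Ob : ValuationSubring L) (hBOb : ∀ b : B, (b : L) ∈ Ob)
    (πb : Ob →+* L') (hπbsurj : Function.Surjective πb)
    (hπbker : ∀ o : Ob, πb o = 0 ↔ ¬ IsUnit o)
    (hπbB : ∀ b : B, πb ⟨(b : L), hBOb b⟩ = φ b)
    -- a simple graded KH-module V, with graded lattices and modular reductions for θ and θ'
    (V : GrMod A H 𝒜 K) (hV : V.forget.Simple)
    (LVθ : AddSubgroup V.carrier) (hLVθ : V.IsLattice O LVθ)
    (Yθ : GrMod A H 𝒜 L) (φθ : LVθ →+ Yθ.carrier)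
    (hYθ : GrMod.Reduces O π V LVθ Yθ φθ)
    (LVθ' : AddSubgroup V.carrier) (hLVθ' : V.IsLattice O' LVθ')
    (Yθ' : GrMod A H 𝒜 L') (φθ' : LVθ' →+ Yθ'.carrier)
    (hYθ' : GrMod.Reduces O' π' V LVθ' Yθ' φθ')
    -- a complete irredundant family of simple graded LH-modules, with lattices and reductions
    (r : ℕ) (N : Fin r → GrMod A H 𝒜 L) (hNsimp : ∀ t, (N t).forget.Simple)
    (hNdisj : ∀ t t', t ≠ t' → ¬ ModPkg.Iso (N t).forget (N t').forget)
    (hNcompl : ∀ P : ModPkg A H L, P.Simple → ∃ t, ModPkg.Iso P (N t).forget)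
    (LN : ∀ t, AddSubgroup (N t).carrier) (hLN : ∀ t, (N t).IsLattice Ob (LN t))
    (W : Fin r → GrMod A H 𝒜 L') (φN : ∀ t, (LN t) →+ (W t).carrier)
    (hW : ∀ t, GrMod.Reduces Ob πb (N t) (LN t) (W t) (φN t))
    -- a simple graded L'H-module M, and graded composition series of the reductions
    (M : GrMod A H 𝒜 L') (hM : M.forget.Simple)
    (csθ' : GrCompSeries Yθ') (csθ : GrCompSeries Yθ)
    (csW : ∀ t, GrCompSeries (W t)) :
    Yθ'.entryPoly csθ' M =
      ∑ t, (W t).entryPoly (csW t) M * Yθ.entryPoly csθ (N t) := by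
  classical
  -- each factor of `Yθ` is a shift of some `N t`
  obtain ⟨Q, hQ, hQs⟩ := Yθ.exists_factors csθ
  have hex : ∀ s, ∃ (t : Fin r) (j : ℤ), (Q s).IsShiftOf (N t) j := by
    intro s
    obtain ⟨t, e, he1, he2⟩ := hNcompl (Q s).forget (hQs s).simple
    refine ⟨t, ?_⟩
    let f : (Q s).carrier →ₗ[L] (N t).carrier := { e.toAddMonoidHom with map_smul' := he1 }
    refine GrMod.exists_shift (hQs s) (GrMod.grSimple_of_simple (hNsimp t)) f he2 ?_
    obtain ⟨x, hx⟩ := @exists_ne _ (hQs s).1 (0 : (Q s).carrier)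
    exact ⟨x, fun h0 => hx (e.injective (h0.trans (map_zero e).symm))⟩
  choose τ j hτ using hex
  have huniq : ∀ s t n, (Q s).IsShiftOf (N t) n ↔ τ s = t ∧ j s = n := by
    intro s t n
    constructor
    · intro h
      have ht : τ s = t := by
        by_contra hne
        obtain ⟨e, e1, e2, -⟩ := (hτ s).symm.trans h
        exact hNdisj _ _ hne ⟨e, e1, e2⟩
      subst ht
      exact ⟨rfl, (hτ s).unique (hQs s).1 h⟩
    · rintro ⟨rfl, rfl⟩
      exact hτ s
  -- the decomposition numbers of `Yθ`
  have hentry : ∀ t, Yθ.entryPoly csθ (N t) =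
      ∑ s, if τ s = t then (LaurentPolynomial.T (j s) : LaurentPolynomial ℕ) else 0 := by
    intro t
    apply LaurentPolynomial.ext
    intro n
    rw [GrMod.entryPoly_coeff, AddMonoidAlgebra.coeff_sum, Finsupp.finsetSum_apply]
    unfold GrMod.multShift
    rw [Nat.card_eq_fintype_card, Fintype.card_subtype, Finset.card_filter]
    refine Finset.sum_congr rfl fun s _ => ?_
    rw [Yθ.isFactorShift_iff (csθ.graded _) (hQ s), huniq]
    by_cases h1 : τ s = t
    · rw [if_pos h1, T_coeff_aux]
      simp [h1]
    · rw [if_neg h1, if_neg (fun h => h1 h.1)]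
      rfl
  -- the product formula for characteristic polynomials
  have hAOb : ∀ a : A, algebraMap A L a ∈ Ob := fun a => hBOb ⟨_, hθB a⟩
  have hπbA : ∀ a : A, πb ⟨algebraMap A L a, hAOb a⟩ = algebraMap A L' a := by
    intro a
    rw [← hφθ a, ← hπbB]
  have hprod : ∀ (h : 𝒜 0) (i : ℤ),
      Yθ'.cpoly h i = ∏ s, (W (τ s)).cpoly h (i - j s) := by
    intro h i
    obtain ⟨c, hc⟩ := V.cpoly_integral h i
    have c1 := V.reduces_map O hAO π hπsurj hπker hπA LVθ hLVθ Yθ φθ hYθ h i c hc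
    have c2 := V.reduces_map O' hAO' π' hπ'surj hπ'ker hπ'A LVθ' hLVθ' Yθ' φθ' hYθ' h i c hc
    have c3 := Yθ.cpoly_eq_prod csθ (fun s => N (τ s)) j
      (fun s => (Yθ.isFactorShift_iff (csθ.graded _) (hQ s) _).mpr (hτ s)) h i
    choose P hP1 hP2 using fun s => (N (τ s)).reduces_cpoly Ob πb hπbsurj hπbker (LN (τ s))
      (hLN (τ s)) (W (τ s)) (φN (τ s)) (hW (τ s)) h (i - j s)
    let ι : A →+* Ob := (algebraMap A L).codRestrict Ob hAOb
    have e1 : Ob.subtype.comp ι = algebraMap A L := rfl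
    have e2 : πb.comp ι = algebraMap A L' := RingHom.ext hπbA
    have e3 : c.map ι = ∏ s, P s := by
      apply Polynomial.map_injective Ob.subtype Subtype.val_injective
      rw [Polynomial.map_map, e1, c1, c3, Polynomial.map_prod]
      exact Finset.prod_congr rfl fun s _ => (hP1 s).symm
    rw [← c2, ← e2, ← Polynomial.map_map, e3, Polynomial.map_prod]
    exact Finset.prod_congr rfl fun s _ => hP2 s
  -- separation
  obtain ⟨Q', hQ', hQs'⟩ := Yθ'.exists_factors csθ'
  choose R hR hRs using fun t => (W t).exists_factors (csW t)
  obtain ⟨x0, hx0⟩ := @exists_ne _ ((GrMod.simple_iff M).mp hM).1 (0 : M.carrier)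
  obtain ⟨i0, hi0⟩ := M.exists_pr_ne_zero hx0
  have hd : 0 < Module.finrank L' (M.grading i0) := by
    rw [Module.finrank_pos_iff]
    exact ⟨⟨⟨_, M.pr_mem i0 x0⟩, 0, fun h => hi0 (congrArg Subtype.val h)⟩⟩
  let Sf : (Fin csθ'.len ⊕ Σ t : Fin r, Fin (csW t).len) → GrMod A H 𝒜 L' :=
    Sum.elim Q' (fun p => R p.1 p.2)
  have hSf : ∀ s, (Sf s).GrSimple := by
    rintro (s | s)
    · exact hQs' s
    · exact hRs s.1 s.2
  obtain ⟨h, b, hb, hhM, hhS⟩ := GrMod.separation hL'frac hsplitL' M hM Sf hSf i0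
  have m1 := GrMod.rootMult_multShift M i0 h b hb hhM Yθ' csθ' Q' hQ' hQs'
    (fun t => hhS (Sum.inl t))
  have m2 := fun t => GrMod.rootMult_multShift M i0 h b hb hhM (W t) (csW t) (R t) (hR t) (hRs t)
    (fun s => hhS (Sum.inr ⟨t, s⟩))
  have hmult : ∀ n, Yθ'.multShift csθ' M n =
      ∑ s, (W (τ s)).multShift (csW (τ s)) M (n - j s) := by
    intro n
    apply Nat.eq_of_mul_eq_mul_right hd
    rw [← m1, hprod, rootMultiplicity_prod_aux _ _ (fun t _ => GrMod.cpoly_ne_zero _ _ _),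
      Finset.sum_mul]
    refine Finset.sum_congr rfl fun s _ => ?_
    rw [← m2, add_sub_assoc]
  -- conclusion
  have hrhs : ∑ t, (W t).entryPoly (csW t) M * Yθ.entryPoly csθ (N t) =
      ∑ s, (W (τ s)).entryPoly (csW (τ s)) M * LaurentPolynomial.T (j s) := by
    simp_rw [hentry, Finset.mul_sum]
    rw [Finset.sum_comm]
    refine Finset.sum_congr rfl fun s _ => ?_
    simp
  rw [hrhs]
  apply LaurentPolynomial.ext
  intro n
  rw [GrMod.entryPoly_coeff, hmult, AddMonoidAlgebra.coeff_sum, Finsupp.finsetSum_apply]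
  refine Finset.sum_congr rfl fun s _ => ?_
  rw [mul_T_coeff_aux, GrMod.entryPoly_coeff]
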